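/- arXiv:2310.03709 — 4 statements merged into one kernel-verified Lean document; each statement's English description precedes it below -/
import Mathlib

section
/- Let K be a quadratic number field, E an elliptic curve over K, and L a quadratic extension of K. If the 2-primary torsion subgroup E(K)[2^∞] is isomorphic to C_2, then E(L) contains no subgroup isomorphic to C_2 ⊕ C_4. -/
open WeierstrassCurve WeierstrassCurve.Affine

/-- The `n`-torsion subgroup `G[n]` of an additive commutative group `G`. -/
def nTorsion (G : Type*) [AddCommGroup G] (n : ℕ) : AddSubgroup G where
  carrier := {x | n • x = 0}
  zero_mem' := by simp
  add_mem' := by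
    intro a b ha hb
    simp only [Set.mem_setOf_eq, smul_add] at *
    rw [ha, hb, add_zero]
  neg_mem' := by
    intro a ha
    simp only [Set.mem_setOf_eq, smul_neg] at *
    rw [ha, neg_zero]

/-- The `p`-primary torsion subgroup `G[p^∞]` of an additive commutative group `G`. -/
def pPrimary (G : Type*) [AddCommGroup G] (p : ℕ) : AddSubgroup G where
  carrier := {x | ∃ k : ℕ, p ^ k • x = 0}
  zero_mem' := ⟨0, by simp⟩
  add_mem' := by
    rintro a b ⟨m, hm⟩ ⟨n, hn⟩
    refine ⟨m + n, ?_⟩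
    have h1 : (p ^ (m + n)) • a = 0 := by rw [pow_add, mul_comm, mul_smul, hm, smul_zero]
    have h2 : (p ^ (m + n)) • b = 0 := by rw [pow_add, mul_smul, hn, smul_zero]
    rw [smul_add, h1, h2, add_zero]
  neg_mem' := by
    rintro a ⟨m, hm⟩
    exact ⟨m, by rw [smul_neg, hm, neg_zero]⟩

/-- The Weierstrass curve over `K` with short Weierstrass equation `y² = x³ + Ax + B`. -/
def shortW {K : Type*} [CommRing K] (A B : K) : WeierstrassCurve K :=
  ⟨0, 0, 0, A, B⟩

/-- The group-theoretic core: an involution whose fixed 2-primary part has at most two elements. -/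
theorem core_aux {G : Type*} [AddCommGroup G] (s : G →+ G) (hs : ∀ x, s (s x) = x) (T : G)
    (hT : T + T = 0)
    (hfix : ∀ x : G, 4 • x = 0 → s x = x → x = 0 ∨ x = T)
    (P S : G) (hP : 4 • P = 0) (hP2 : P + P ≠ 0) (hS : S + S = 0) (hS0 : S ≠ 0)
    (hSP : S ≠ P + P) : False := by
  have hN : ∀ x : G, 4 • x = 0 → x + s x = 0 ∨ x + s x = T := by
    intro x hx
    apply hfix
    · rw [smul_add, ← map_nsmul, hx, map_zero, add_zero]
    · rw [map_add, hs, add_comm]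
  have hN2 : ∀ x : G, x + x = 0 → x + s x = 0 → x = 0 ∨ x = T := by
    intro x hx h
    apply hfix
    · have : 4 • x = (x + x) + (x + x) := by abel
      rw [this, hx, add_zero]
    · rw [eq_neg_of_add_eq_zero_right h, ← eq_neg_of_add_eq_zero_right hx]
  have hS4 : 4 • S = 0 := by
    have : 4 • S = (S + S) + (S + S) := by abel
    rw [this, hS, add_zero]
  have hR2 : (P + P) + (P + P) = 0 := by
    rw [← hP]; abel
  have hRN : (P + P) + s (P + P) = 0 := by
    have e : (P + P) + s (P + P) = (P + s P) + (P + s P) := by rw [map_add]; abel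
    rw [e]
    rcases hN P hP with h | h <;> rw [h]
    · simp
    · exact hT
  have hR : P + P = T := (hN2 _ hR2 hRN).resolve_left hP2
  have hSN : S + s S = T := by
    refine (hN S hS4).resolve_left fun h => ?_
    rcases hN2 S hS h with h | h
    · exact hS0 h
    · exact hSP (h.trans hR.symm)
  have key : ∀ Q : G, 4 • Q = 0 → Q + Q = T → Q + s Q = T → False := by
    intro Q hQ4 hQ h
    have : s Q = Q := add_left_cancel (h.trans hQ.symm)
    rcases hfix Q hQ4 this with h0 | h0
    · apply hP2; rw [hR, ← hQ, h0, add_zero]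
    · apply hP2; rw [hR, ← hQ, h0, hT]
  rcases hN P hP with h | h
  · refine key (P + S) ?_ ?_ ?_
    · rw [smul_add, hP, hS4, add_zero]
    · rw [add_add_add_comm, hS, hR, add_zero]
    · rw [map_add, add_add_add_comm, h, hSN, zero_add]
  · exact key P hP hR h

/-- A quadratic extension of a characteristic-zero field has an involution with fixed field `K`. -/
theorem exists_invol {K L : Type*} [Field K] [CharZero K] [Field L] [Algebra K L]
    (hL : Module.finrank K L = 2) :
    ∃ s : L →ₐ[K] L, (∀ x, s (s x) = x) ∧ ∀ x, s x = x → ∃ a : K, algebraMap K L a = x := by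
  have : FiniteDimensional K L := Module.finite_of_finrank_pos (by omega)
  have : Algebra.IsQuadraticExtension K L := ⟨hL⟩
  have : IsGalois K L := ⟨⟩
  have hc : Nat.card (L ≃ₐ[K] L) = 2 := by rw [IsGalois.card_aut_eq_finrank, hL]
  obtain ⟨t, ht, hu⟩ := (Nat.card_eq_two_iff' (1 : L ≃ₐ[K] L)).1 hc
  refine ⟨t, fun x => ?_, fun x hx => ?_⟩
  · have h : t ^ 2 = 1 := by rw [← hc]; exact pow_card_eq_one'
    have := DFunLike.congr_fun h x
    rwa [pow_two] at this
  · refine (IsGalois.mem_range_algebraMap_iff_fixed x).2 fun f => ?_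
    by_cases hf : f = 1
    · rw [hf]; rfl
    · rw [hu f hf]; exact hx

open scoped Classical in
/-- Points fixed by the involution come from points over `K`. -/
theorem descend {K L : Type*} [Field K] [Field L] [Algebra K L] (W : WeierstrassCurve K)
    (s : L →ₐ[K] L) (hs : ∀ x, s x = x → ∃ a : K, algebraMap K L a = x)
    (P : (W.baseChange L).toAffine.Point) (hP : Point.map (W' := W) s P = P) :
    ∃ Q : (W.baseChange K).toAffine.Point, Point.map (W' := W) (Algebra.ofId K L) Q = P := by
  rcases P with _ | ⟨x, y, h⟩
  · exact ⟨0, rfl⟩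
  · rw [Point.map_some] at hP
    simp only [Point.some.injEq] at hP
    obtain ⟨a, rfl⟩ := hs x hP.1
    obtain ⟨b, rfl⟩ := hs y hP.2
    exact ⟨Point.some a b ((Affine.baseChange_nonsingular W (Algebra.ofId K L).injective a b).1 h), rfl⟩

open scoped Classical in
/-- Let `K` be a quadratic number field, `E` an elliptic curve over `K`, and
`L` a quadratic extension of `K`. If `E(K)[2^∞] ≃ C₂`, then `E(L)` contains no subgroup
isomorphic to `C₂ ⊕ C₄`. -/
theorem stmt0 {K : Type*} [Field K] [NumberField K] (hK : Module.finrank ℚ K = 2)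
    {L : Type*} [Field L] [Algebra K L] (hL : Module.finrank K L = 2)
    (W : WeierstrassCurve K) (hW : W.Δ ≠ 0)
    (h2 : Nonempty (pPrimary (W.baseChange K).toAffine.Point 2 ≃+ ZMod 2)) :
    ¬ ∃ H : AddSubgroup (W.baseChange L).toAffine.Point, Nonempty (H ≃+ (ZMod 2 × ZMod 4)) := by
  rintro ⟨H, ⟨e⟩⟩
  obtain ⟨f⟩ := h2
  obtain ⟨s, hs, hf⟩ := exists_invol hL
  let φ := Point.map (W' := W) (Algebra.ofId K L)
  have hφ : Function.Injective φ := Point.map_injective (W' := W) (Algebra.ofId K L)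
  have e1 : ∀ z : ZMod 2 × ZMod 4, ((e.symm z : H) : (W.baseChange L).toAffine.Point) = 0 → z = 0 := by
    intro z hz
    have : e.symm z = 0 := Subtype.ext hz
    simpa using this
  refine core_aux (Point.map (W' := W) s) ?_ (φ (f.symm 1 : pPrimary _ 2)) ?_ ?_
    (e.symm (0, 1) : H) (e.symm (1, 0) : H) ?_ ?_ ?_ ?_ ?_
  · intro x
    rw [Point.map_map]
    have : s.comp s = AlgHom.id K L := AlgHom.ext hs
    rw [this]
    rcases x with _ | ⟨x, y, h⟩ <;> rfl
  · rw [← map_add, ← AddSubgroup.coe_add, ← map_add]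
    have : (1 + 1 : ZMod 2) = 0 := by decide
    rw [this]; simp
  · intro x hx hsx
    obtain ⟨Q, rfl⟩ := descend W s hf x hsx
    have hQ : 4 • Q = 0 := by
      apply hφ
      rw [map_nsmul, map_zero]; exact hx
    have hQm : Q ∈ pPrimary (W.baseChange K).toAffine.Point 2 := ⟨2, by simpa using hQ⟩
    have hz : ∀ z : ZMod 2, z = 0 ∨ z = 1 := by decide
    rcases hz (f ⟨Q, hQm⟩) with h | h
    · left
      have h' : (⟨Q, hQm⟩ : pPrimary (W.baseChange K).toAffine.Point 2) = 0 := by simpa using h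
      have : Q = 0 := congrArg Subtype.val h'
      rw [this, map_zero]
    · right
      rw [← h, f.symm_apply_apply]
  · rw [← AddSubgroup.coe_nsmul, ← map_nsmul]
    have : (4 • (0, 1) : ZMod 2 × ZMod 4) = 0 := by decide
    rw [this]; simp
  · rw [← AddSubgroup.coe_add, ← map_add]
    intro h
    exact absurd (e1 _ h) (by decide)
  · rw [← AddSubgroup.coe_add, ← map_add]
    have : ((1, 0) + (1, 0) : ZMod 2 × ZMod 4) = 0 := by decide
    rw [this]; simp
  · intro h
    exact absurd (e1 _ h) (by decide)
  · rw [← AddSubgroup.coe_add, ← map_add]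
    intro h
    exact absurd (e.symm.injective (Subtype.ext h)) (by decide)
end

section
/- Let K be a quadratic number field, E an elliptic curve over K, and L a quadratic extension of K. If E(K)_tor is isomorphic to C_4, then E(L)_tor is not isomorphic to C_16. -/
open WeierstrassCurve WeierstrassCurve.Affine

theorem zmod16_aux : ∀ u x : ZMod 16, u * u = 1 → u * x = x → 4 * x = 0 → 2 * x ≠ 0 → u * 2 = 2 := by
  decide

/-- Abstract group-theoretic core: an involution of `C₁₆` never has fixed group `C₄`. -/
theorem descent_aux {A B : Type*} [AddCommGroup A] [AddCommGroup B] (φ : A →+ B)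
    (hφ : Function.Injective φ) (s : B →+ B) (hs : ∀ b, s (s b) = b)
    (hsφ : ∀ a, s (φ a) = φ a) (hfix : ∀ b, s b = b → ∃ a, φ a = b)
    (e4 : AddCommGroup.torsion A ≃+ ZMod 4) (e : AddCommGroup.torsion B ≃+ ZMod 16) : False := by
  have tor : ∀ b : B, b ∈ AddCommGroup.torsion B → s b ∈ AddCommGroup.torsion B :=
    fun b hb => s.isOfFinAddOrder hb
  let t : AddCommGroup.torsion B →+ AddCommGroup.torsion B :=
    { toFun := fun b => ⟨s b, tor b b.2⟩
      map_zero' := by ext; simp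
      map_add' := by intro a b; ext; simp }
  have ht : ∀ b, ((t b : AddCommGroup.torsion B) : B) = s b := fun _ => rfl
  let f : ZMod 16 →+ ZMod 16 := (e.toAddMonoidHom.comp t).comp e.symm.toAddMonoidHom
  have hf : ∀ b, f (e b) = e (t b) := by intro b; simp [f]
  have hff : ∀ x, f (f x) = x := by
    intro x
    obtain ⟨b, rfl⟩ := e.surjective x
    rw [hf, hf]
    congr 1
    ext
    rw [ht, ht, hs]
  have hfu : ∀ x, f x = f 1 * x := by
    intro x
    have h := map_nsmul f x.val 1
    simp only [nsmul_eq_mul, mul_one, ZMod.natCast_val, ZMod.cast_id', id_eq] at h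
    rw [h, mul_comm]
  -- a point of order four
  let a : AddCommGroup.torsion A := e4.symm 1
  have ha4 : 4 • (a : A) = 0 := by
    have : 4 • a = 0 := by
      apply e4.injective
      rw [map_nsmul, map_zero]
      simp only [a, AddEquiv.apply_symm_apply]
      decide
    exact_mod_cast congrArg Subtype.val this
  have ha2 : 2 • (a : A) ≠ 0 := by
    intro h
    have h2 : 2 • a = 0 := by ext; exact_mod_cast h
    have := congrArg e4 h2
    rw [map_nsmul, map_zero] at this
    simp only [a, AddEquiv.apply_symm_apply] at this
    revert this
    decide
  let b : AddCommGroup.torsion B := ⟨φ a, φ.isOfFinAddOrder a.2⟩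
  have hb4 : 4 * e b = 0 := by
    have : 4 • b = 0 := by
      ext
      change 4 • φ a = 0
      rw [← map_nsmul, ha4, map_zero]
    have := congrArg e this
    rw [map_nsmul, map_zero] at this
    simpa using this
  have hb2 : 2 * e b ≠ 0 := by
    intro h
    have h' : e (2 • b) = e 0 := by
      rw [map_nsmul, map_zero]
      simpa using h
    have h2 : 2 • φ a = 0 := congrArg Subtype.val (e.injective h')
    rw [← map_nsmul] at h2
    exact ha2 (hφ (by rw [h2, map_zero]))
  have hbf : f 1 * e b = e b := by
    rw [← hfu, hf]
    congr 1
    ext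
    exact hsφ a
  have key := zmod16_aux (f 1) (e b) (by rw [← hfu, hff]) hbf hb4 hb2
  -- a fixed point of order eight
  let c : AddCommGroup.torsion B := e.symm 2
  have hc : s (c : B) = c := by
    have : t c = c := by
      apply e.injective
      rw [← hf, hfu]
      simpa [c] using key
    exact congrArg Subtype.val this
  obtain ⟨d, hd⟩ := hfix c hc
  have hdt : d ∈ AddCommGroup.torsion A := by
    have h := c.2
    rw [← hd] at h
    exact isOfFinAddOrder_iff_nsmul_eq_zero.2 (by
      obtain ⟨n, hn, h⟩ := isOfFinAddOrder_iff_nsmul_eq_zero.1 h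
      exact ⟨n, hn, hφ (by rw [map_nsmul, h, map_zero])⟩)
  have hd4 : 4 • (⟨d, hdt⟩ : AddCommGroup.torsion A) = 0 := by
    apply e4.injective
    rw [map_nsmul, map_zero]
    generalize e4 _ = z
    revert z
    decide
  have hd4' : 4 • d = 0 := congrArg Subtype.val hd4
  have hc4 : 4 • c = 0 := by
    ext
    change 4 • (c : B) = 0
    rw [← hd, ← map_nsmul, hd4', map_zero]
  have := congrArg e hc4
  rw [map_nsmul, map_zero] at this
  simp only [c, AddEquiv.apply_symm_apply] at this
  revert this
  decide

open scoped Classical in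
/-- Let `K` be a quadratic number field, `E` an elliptic curve over `K`, and
`L` a quadratic extension of `K`. If `E(K)_tor ≃ C₄`, then `E(L)_tor ≄ C₁₆`. -/
theorem stmt3 {K : Type*} [Field K] [NumberField K] (hK : Module.finrank ℚ K = 2)
    {L : Type*} [Field L] [Algebra K L] (hL : Module.finrank K L = 2)
    (W : WeierstrassCurve K) (hW : W.Δ ≠ 0)
    (h4 : Nonempty (AddCommGroup.torsion (W⁄K).Point ≃+ ZMod 4)) :
    IsEmpty (AddCommGroup.torsion (W⁄L).Point ≃+ ZMod 16) := by
  classical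
  obtain ⟨e4⟩ := h4
  refine ⟨fun e => ?_⟩
  have : Algebra.IsQuadraticExtension K L := ⟨hL⟩
  have : FiniteDimensional K L := FiniteDimensional.of_finrank_pos (by omega)
  have : IsGalois K L := {}
  have hcard : Nat.card (L ≃ₐ[K] L) = 2 := by rw [IsGalois.card_aut_eq_finrank, hL]
  obtain ⟨σ, -, hσ⟩ := (Nat.card_eq_two_iff' (1 : L ≃ₐ[K] L)).1 hcard
  have hall : ∀ τ : L ≃ₐ[K] L, τ = 1 ∨ τ = σ := fun τ => by
    by_cases h : τ = 1
    · exact Or.inl h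
    · exact Or.inr (hσ τ h)
  have hσσ : ∀ x, σ (σ x) = x := by
    intro x
    have h : σ ^ 2 = 1 := by rw [← hcard]; exact pow_card_eq_one'
    rw [pow_two] at h
    exact DFunLike.congr_fun h x
  have hfixed : ∀ x : L, σ x = x → ∃ y : K, Algebra.ofId K L y = x := by
    intro x hx
    refine (IsGalois.mem_range_algebraMap_iff_fixed x).2 fun τ => ?_
    rcases hall τ with rfl | rfl
    · rfl
    · exact hx
  refine descent_aux (Point.map (W' := W) (Algebra.ofId K L)) (Point.map_injective _)
    (Point.map (W' := W) (σ : L →ₐ[K] L)) ?_ ?_ ?_ e4 e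
  · rintro (_ | ⟨x, y, h⟩)
    · rfl
    · simp [Point.map_some, hσσ]
  · rintro (_ | ⟨x, y, h⟩)
    · rfl
    · simp [Point.map_some, Algebra.ofId_apply]
  · rintro (_ | ⟨x, y, h⟩) hP
    · exact ⟨0, rfl⟩
    · simp only [Point.map_some, Point.some.injEq] at hP
      obtain ⟨x, rfl⟩ := hfixed x hP.1
      obtain ⟨y, rfl⟩ := hfixed y hP.2
      exact ⟨Point.some x y ((WeierstrassCurve.Affine.baseChange_nonsingular (W := W) (Algebra.ofId K L).injective ..).mp h), rfl⟩
end

section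
/- Let K be a quadratic number field, E an elliptic curve over K given by y² = x³ + Ax + B, d ∈ K a nonsquare, and L = K(√d). If E(K)_tor is isomorphic to C_8 and E(L)_tor is isomorphic to C_2 ⊕ C_16, then E^d(K)_tor is isomorphic to C_4. -/
open WeierstrassCurve WeierstrassCurve.Affine

/-- Pure group theory: an involution on `C₂ × C₁₆` whose fixed group is `C₈` has anti-fixed
group `C₄`. -/
lemma core_group {M N T : Type*} [AddCommGroup M] [AddCommGroup N] [AddCommGroup T]
    (σ : T →+ T) (hσ : ∀ x, σ (σ x) = x) (φ : M →+ T) (ψ : N →+ T)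
    (hφ : Function.Injective φ) (hψ : Function.Injective ψ)
    (hA : ∀ x, (∃ m, φ m = x) ↔ σ x = x) (hB : ∀ x, (∃ n, ψ n = x) ↔ σ x = -x)
    (eM : M ≃+ ZMod 8) (eT : T ≃+ ZMod 2 × ZMod 16) : Nonempty (N ≃+ ZMod 4) := by
  have cM : Nat.card M = 8 := by rw [Nat.card_congr eM.toEquiv]; simp
  have cT : Nat.card T = 32 := by rw [Nat.card_congr eT.toEquiv]; simp
  have fT : Finite T := Nat.finite_of_card_ne_zero (by omega)
  have fN : Finite N := Finite.of_injective ψ hψ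
  let f : T →+ T := AddMonoidHom.id T + σ
  let g : T →+ T := AddMonoidHom.id T - σ
  have hf : ∀ x, f x = x + σ x := fun x => rfl
  have hg : ∀ x, g x = x - σ x := fun x => rfl
  have kf : f.ker = ψ.range := by
    ext x
    rw [AddMonoidHom.mem_ker, AddMonoidHom.mem_range, hB, hf, add_comm, add_eq_zero_iff_eq_neg]
  have kg : g.ker = φ.range := by
    ext x
    rw [AddMonoidHom.mem_ker, AddMonoidHom.mem_range, hA, hg, sub_eq_zero, eq_comm]
  have cA : Nat.card φ.range = 8 := by
    rw [← cM]; exact (Nat.card_congr (AddMonoidHom.ofInjective hφ).toEquiv).symm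
  have cB : Nat.card ψ.range = Nat.card N :=
    (Nat.card_congr (AddMonoidHom.ofInjective hψ).toEquiv).symm
  have rf : f.range ≤ φ.range := by
    rintro _ ⟨x, rfl⟩
    rw [AddMonoidHom.mem_range, hA, hf, map_add, hσ, add_comm]
  have card_f : Nat.card f.ker * Nat.card f.range = 32 := by
    rw [← cT, ← AddSubgroup.card_mul_index f.ker, AddSubgroup.index_ker]
  have card_g : Nat.card g.ker * Nat.card g.range = 32 := by
    rw [← cT, ← AddSubgroup.card_mul_index g.ker, AddSubgroup.index_ker]
  rw [kg, cA] at card_g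
  rw [kf, cB] at card_f
  have cg : Nat.card g.range = 4 := by omega
  have kill : ∀ x, 4 • g x = 0 := by
    intro x
    have h := addOrderOf_dvd_natCard (⟨g x, x, rfl⟩ : g.range)
    rw [cg, addOrderOf_dvd_iff_nsmul_eq_zero] at h
    simpa using congrArg Subtype.val h
  -- an element of order 16
  obtain ⟨x, hx⟩ : ∃ x : T, 8 • x ≠ 0 := by
    refine ⟨eT.symm (0, 1), ?_⟩
    rw [← map_nsmul, ne_eq, EmbeddingLike.map_eq_zero_iff]
    decide
  have h4 : 4 • f x ≠ 0 := by
    intro h0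
    apply hx
    have : 8 • x = 4 • f x + 4 • g x := by rw [hf, hg]; abel
    rw [this, h0, kill, add_zero]
  have cf : Nat.card f.range = 8 := by
    have d1 : Nat.card f.range ∣ 8 := cA ▸ AddSubgroup.card_dvd_of_le rf
    have d2 : ¬ Nat.card f.range ∣ 4 := by
      intro h
      have h' := (addOrderOf_dvd_natCard (⟨f x, x, rfl⟩ : f.range)).trans h
      rw [addOrderOf_dvd_iff_nsmul_eq_zero] at h'
      exact h4 (by simpa using congrArg Subtype.val h')
    have le : Nat.card f.range ≤ 8 := Nat.le_of_dvd (by norm_num) d1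
    interval_cases h : Nat.card f.range <;> omega
  have cN : Nat.card N = 4 := by rw [cf] at card_f; omega
  -- not all elements of `N` are killed by 2
  obtain ⟨n, hn⟩ : ∃ n : N, 2 • n ≠ 0 := by
    by_contra! hall
    have lift : ∀ n : N, ∃ m : M, φ m = ψ n := by
      intro n
      rw [hA, (hB (ψ n)).1 ⟨n, rfl⟩, neg_eq_iff_add_eq_zero, ← two_nsmul, ← map_nsmul, hall,
        map_zero]
    choose F hF using lift
    have h2 : ∀ n, 2 • F n = 0 := by
      intro n
      apply hφ
      rw [map_nsmul, hF, ← map_nsmul, hall, map_zero, map_zero]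
    have h3 : ∀ z : ZMod 8, 2 • z = 0 → z = 0 ∨ z = 4 := by decide
    have hinj : Function.Injective (fun n => (decide (eM (F n) = 0) : Bool)) := by
      intro a b hab
      apply hψ
      rw [← hF, ← hF]
      congr 1
      apply eM.injective
      have ha := h3 (eM (F a)) (by rw [← map_nsmul, h2, map_zero])
      have hb := h3 (eM (F b)) (by rw [← map_nsmul, h2, map_zero])
      have h40 : (4 : ZMod 8) ≠ 0 := by decide
      rcases ha with ha | ha <;> rcases hb with hb | hb <;> simp_all
    have := Nat.card_le_card_of_injective _ hinj
    rw [cN] at this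
    simp at this
  have o4 : addOrderOf n = 4 := by
    have d1 : addOrderOf n ∣ 4 := cN ▸ addOrderOf_dvd_natCard n
    have d2 : ¬ addOrderOf n ∣ 2 := by rwa [addOrderOf_dvd_iff_nsmul_eq_zero]
    have le := Nat.le_of_dvd (by norm_num) d1
    interval_cases h : addOrderOf n <;> omega
  have : IsAddCyclic N := isAddCyclic_of_addOrderOf_eq_card n (by rw [o4, cN])
  exact ⟨(cN ▸ (zmodAddCyclicAddEquiv (G := N) inferInstance) : ZMod 4 ≃+ N).symm⟩

/-- Restriction of a homomorphism to torsion subgroups. -/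
def torsMap {G H : Type*} [AddCommGroup G] [AddCommGroup H] (f : G →+ H) :
    AddCommGroup.torsion G →+ AddCommGroup.torsion H :=
  (f.comp (AddCommGroup.torsion G).subtype).codRestrict _
    (fun x => f.isOfFinAddOrder x.2)

lemma tors_key {G T : Type*} [AddCommGroup G] [AddCommGroup T] (f : G →+ T)
    (hf : Function.Injective f) (x : AddCommGroup.torsion T) :
    (∃ m, torsMap f m = x) ↔ ∃ m, f m = x := by
  constructor
  · rintro ⟨m, rfl⟩
    exact ⟨m, rfl⟩
  · rintro ⟨m, hm⟩
    refine ⟨⟨m, ?_⟩, Subtype.ext hm⟩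
    have h := x.2
    rw [← hm] at h
    exact hf.isOfFinAddOrder_iff.1 h

lemma core_tors {M N T : Type*} [AddCommGroup M] [AddCommGroup N] [AddCommGroup T]
    (σ : T →+ T) (hσ : ∀ x, σ (σ x) = x) (φ : M →+ T) (ψ : N →+ T)
    (hφ : Function.Injective φ) (hψ : Function.Injective ψ)
    (hA : ∀ x, (∃ m, φ m = x) ↔ σ x = x) (hB : ∀ x, (∃ n, ψ n = x) ↔ σ x = -x)
    (eM : AddCommGroup.torsion M ≃+ ZMod 8) (eT : AddCommGroup.torsion T ≃+ ZMod 2 × ZMod 16) :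
    Nonempty (AddCommGroup.torsion N ≃+ ZMod 4) := by
  refine core_group (torsMap σ) (fun x => Subtype.ext (hσ x)) (torsMap φ) (torsMap ψ)
    (fun a b h => Subtype.ext (hφ (congrArg Subtype.val h)))
    (fun a b h => Subtype.ext (hψ (congrArg Subtype.val h))) ?_ ?_ eM eT
  · intro x
    rw [tors_key φ hφ, hA, Subtype.ext_iff]; rfl
  · intro x
    rw [tors_key ψ hψ, hB, Subtype.ext_iff]; rfl

open scoped Classical in
/-- Scaling isomorphism between short Weierstrass curves. -/
lemma exists_scaling {F : Type*} [Field F] (a b v : F) (hv : v ≠ 0) :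
    ∃ τ : (shortW a b).toAffine.Point →+ (shortW (v ^ 4 * a) (v ^ 6 * b)).toAffine.Point,
      ∀ x y h, ∃ h', τ (.some x y h) = .some (x * v ^ 2) (y * v ^ 3) h' := by
  have eqn : ∀ x y, (shortW a b).toAffine.Nonsingular x y →
      (shortW (v ^ 4 * a) (v ^ 6 * b)).toAffine.Nonsingular (x * v ^ 2) (y * v ^ 3) := by
    intro x y h
    rw [nonsingular_iff, equation_iff] at h ⊢
    simp only [shortW] at h ⊢
    obtain ⟨h1, h2⟩ := h
    refine ⟨by linear_combination v ^ 6 * h1, ?_⟩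
    rcases h2 with h2 | h2
    · left
      intro h
      apply h2
      apply mul_left_cancel₀ (pow_ne_zero 4 hv)
      linear_combination h
    · right
      intro h
      apply h2
      apply mul_left_cancel₀ (pow_ne_zero 3 hv)
      linear_combination h
  have negY' : ∀ (a b x y : F), (shortW a b).toAffine.negY x y = -y := by
    intro a b x y; simp [negY, shortW]
  refine ⟨⟨⟨fun P => match P with
    | .zero => .zero
    | .some x y h => .some (x * v ^ 2) (y * v ^ 3) (eqn x y h), rfl⟩, ?_⟩,
    fun x y h => ⟨eqn x y h, rfl⟩⟩
  rintro (_ | ⟨x₁, y₁, h₁⟩) (_ | ⟨x₂, y₂, h₂⟩)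
  any_goals rfl
  have v2 := pow_ne_zero 2 hv
  have v3 := pow_ne_zero 3 hv
  by_cases hxy : x₁ = x₂ ∧ y₁ = (shortW a b).toAffine.negY x₂ y₂
  · rw [Point.add_of_Y_eq hxy.1 hxy.2]
    refine (Point.add_of_Y_eq (by rw [hxy.1]) ?_).symm
    rw [hxy.2, negY', negY']; ring
  · have hxy' : ¬ (x₁ * v ^ 2 = x₂ * v ^ 2 ∧ y₁ * v ^ 3 =
        (shortW (v ^ 4 * a) (v ^ 6 * b)).toAffine.negY (x₂ * v ^ 2) (y₂ * v ^ 3)) := by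
      rintro ⟨e1, e2⟩
      refine hxy ⟨mul_right_cancel₀ v2 e1, ?_⟩
      rw [negY'] at e2 ⊢
      apply mul_right_cancel₀ v3
      rw [e2]; ring
    have sl : (shortW (v ^ 4 * a) (v ^ 6 * b)).toAffine.slope (x₁ * v ^ 2) (x₂ * v ^ 2)
        (y₁ * v ^ 3) (y₂ * v ^ 3) = (shortW a b).toAffine.slope x₁ x₂ y₁ y₂ * v := by
      by_cases hx : x₁ = x₂
      · have hy : y₁ ≠ (shortW a b).toAffine.negY x₂ y₂ := fun h => hxy ⟨hx, h⟩
        have hyy := Y_eq_of_Y_ne h₁.1 h₂.1 hx hy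
        rw [slope_of_Y_ne hx hy, slope_of_Y_ne (by rw [hx]) (fun h => hxy' ⟨by rw [hx], h⟩)]
        rw [negY'] at hy
        rw [negY', negY']
        have h2 : y₁ - -y₁ ≠ 0 := fun h => hy (by rw [← hyy]; exact sub_eq_zero.1 h)
        have h3 : y₁ * v ^ 3 - -(y₁ * v ^ 3) ≠ 0 := by
          intro h; apply mul_ne_zero h2 v3; linear_combination h
        rw [div_mul_eq_mul_div, div_eq_div_iff h3 h2]
        simp only [shortW]
        ring
      · rw [slope_of_X_ne hx, slope_of_X_ne (fun h => hx (mul_right_cancel₀ v2 h))]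
        have h2 := sub_ne_zero.2 hx
        have h3 : x₁ * v ^ 2 - x₂ * v ^ 2 ≠ 0 := by
          rw [← sub_mul]; exact mul_ne_zero h2 v2
        rw [div_mul_eq_mul_div, div_eq_div_iff h3 h2]
        ring
    rw [Point.add_some hxy]
    refine Eq.trans ?_ (Point.add_some hxy').symm
    simp only [Point.some.injEq, sl]
    simp only [addX, addY, negAddY, negY, shortW]
    constructor <;> ring

open scoped Classical in
lemma exists_scaling' {F : Type*} [Field F] (W₁ W₂ : WeierstrassCurve F) (a b v : F) (hv : v ≠ 0)
    (h₁ : W₁ = shortW a b) (h₂ : W₂ = shortW (v ^ 4 * a) (v ^ 6 * b)) :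
    ∃ τ : W₁.toAffine.Point →+ W₂.toAffine.Point,
      ∀ x y h, ∃ h', τ (.some x y h) = .some (x * v ^ 2) (y * v ^ 3) h' := by
  subst h₁ h₂
  exact exists_scaling a b v hv

open scoped Classical in
/-- Let `K` be a quadratic number field, `E : y² = x³ + Ax + B` an elliptic
curve over `K`, `d ∈ K` a nonsquare and `L = K(√d)`. If `E(K)_tor ≃ C₈` and
`E(L)_tor ≃ C₂ ⊕ C₁₆`, then `E^d(K)_tor ≃ C₄`. -/
theorem stmt4 {K : Type*} [Field K] [NumberField K] (hK : Module.finrank ℚ K = 2)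
    (A B d : K) (hd : ¬ ∃ c : K, c ^ 2 = d) (hΔ : (shortW A B).Δ ≠ 0)
    {L : Type*} [Field L] [Algebra K L] (hL : Module.finrank K L = 2)
    (s : L) (hs : s ^ 2 = algebraMap K L d)
    (h8 : Nonempty (AddCommGroup.torsion (Affine.Point (WeierstrassCurve.baseChange (shortW A B) K)) ≃+ ZMod 8))
    (h216 : Nonempty (AddCommGroup.torsion (Affine.Point (WeierstrassCurve.baseChange (shortW A B) L)) ≃+ (ZMod 2 × ZMod 16))) :
    Nonempty (AddCommGroup.torsion (Affine.Point (WeierstrassCurve.baseChange (shortW (d ^ 2 * A) (d ^ 3 * B)) K)) ≃+ ZMod 4) := by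
  obtain ⟨e8⟩ := h8
  obtain ⟨e216⟩ := h216
  have : Algebra.IsQuadraticExtension K L := ⟨hL⟩
  have : FiniteDimensional K L := inferInstance
  have : IsGalois K L := inferInstance
  have d0 : d ≠ 0 := fun h => hd ⟨0, by rw [h]; ring⟩
  have inj : Function.Injective (algebraMap K L) := (algebraMap K L).injective
  have s0 : s ≠ 0 := by
    rintro rfl
    apply d0
    apply inj
    rw [← hs, map_zero]; ring
  have sK : ∀ c : K, algebraMap K L c ≠ s := by
    intro c hc
    apply hd
    refine ⟨c, inj ?_⟩
    rw [map_pow, hc, hs]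
  obtain ⟨σ, hσs⟩ : ∃ σ : L ≃ₐ[K] L, σ s ≠ s := by
    by_contra! h
    obtain ⟨c, hc⟩ := IntermediateField.mem_bot.1 ((IsGalois.mem_bot_iff_fixed s).2 h)
    exact sK c hc
  have cG : Nat.card (L ≃ₐ[K] L) = 2 := by rw [IsGalois.card_aut_eq_finrank, hL]
  have σσ : ∀ z, σ (σ z) = z := by
    intro z
    have h : σ ^ 2 = 1 := by rw [← cG]; exact pow_card_eq_one'
    have := congrArg (fun e : L ≃ₐ[K] L => e z) h
    rwa [pow_two] at this
  have σ1 : σ ≠ 1 := fun h => hσs (by rw [h]; rfl)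
  have only : ∀ e : L ≃ₐ[K] L, e = 1 ∨ e = σ := by
    intro e
    have : Finite (L ≃ₐ[K] L) := Nat.finite_of_card_ne_zero (by omega)
    by_contra! h
    obtain ⟨x, y, hxy, hu⟩ := Nat.card_eq_two_iff.1 cG
    have m : ∀ z : L ≃ₐ[K] L, z = x ∨ z = y := fun z => by
      have : z ∈ ({x, y} : Set (L ≃ₐ[K] L)) := hu ▸ Set.mem_univ z
      simpa using this
    obtain ⟨h1, h2⟩ := h
    rcases m e with a | a <;> rcases m σ with b | b <;> rcases m 1 with c | c <;> simp_all
  have fixK : ∀ z, σ z = z → ∃ c : K, algebraMap K L c = z := by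
    intro z hz
    refine IntermediateField.mem_bot.1 ((IsGalois.mem_bot_iff_fixed z).2 fun e => ?_)
    rcases only e with rfl | rfl
    · rfl
    · exact hz
  have σs : σ s = -s := by
    have h : σ s ^ 2 = s ^ 2 := by rw [← map_pow, hs]; exact σ.commutes d
    exact (sq_eq_sq_iff_eq_or_eq_neg.1 h).resolve_left hσs
  have antiK : ∀ z, σ z = -z → ∃ c : K, algebraMap K L c * s = z := by
    intro z hz
    obtain ⟨c, hc⟩ := fixK (z / s) (by rw [map_div₀, hz, σs, neg_div_neg_eq])
    exact ⟨c, by rw [hc, div_mul_cancel₀ _ s0]⟩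
  -- the twist
  have eA : s⁻¹ ^ 4 * algebraMap K L (d ^ 2 * A) = algebraMap K L A := by
    rw [map_mul, map_pow, ← hs]; field_simp
  have eB : s⁻¹ ^ 6 * algebraMap K L (d ^ 3 * B) = algebraMap K L B := by
    rw [map_mul, map_pow, ← hs]; field_simp
  have bc : ∀ a b : K, WeierstrassCurve.baseChange (shortW a b) L =
      shortW (algebraMap K L a) (algebraMap K L b) := by
    intro a b
    simp [shortW, WeierstrassCurve.baseChange, WeierstrassCurve.map]
  obtain ⟨τ, hτ⟩ := exists_scaling' (WeierstrassCurve.baseChange (shortW (d ^ 2 * A) (d ^ 3 * B)) L)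
    (WeierstrassCurve.baseChange (shortW A B) L) _ _ s⁻¹ (inv_ne_zero s0) (bc _ _)
    (by rw [eA, eB]; exact bc _ _)
  have negE : ∀ x y, (WeierstrassCurve.baseChange (shortW A B) L).toAffine.negY x y = -y := by
    intro x y; simp [negY, shortW]
  have τinj : Function.Injective τ := by
    rw [injective_iff_map_eq_zero]
    rintro (_ | ⟨x, y, h⟩) h0
    · rfl
    · obtain ⟨h', e⟩ := hτ x y h
      rw [e] at h0
      exact absurd h0 (Point.some_ne_zero h')
  let σm := Point.map (W' := shortW A B) (σ : L →ₐ[K] L)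
  let φ := Point.map (W' := shortW A B) (Algebra.ofId K L)
  let ρ := Point.map (W' := shortW (d ^ 2 * A) (d ^ 3 * B)) (Algebra.ofId K L)
  refine core_tors σm ?_ φ (τ.comp ρ) (Point.map_injective _)
    (τinj.comp (Point.map_injective _)) ?_ ?_ e8 e216
  · rintro (_ | ⟨x, y, h⟩)
    · rfl
    · simp only [σm, Point.map_some, Point.some.injEq]
      exact ⟨σσ x, σσ y⟩
  · intro P
    constructor
    · rintro ⟨_ | ⟨x, y, h⟩, rfl⟩
      · rfl
      · simp only [σm, φ, Point.map_some, Point.some.injEq]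
        exact ⟨σ.commutes x, σ.commutes y⟩
    · rcases P with _ | ⟨x, y, h⟩
      · intro _; exact ⟨0, rfl⟩
      · intro e
        simp only [σm, Point.map_some, Point.some.injEq] at e
        obtain ⟨a, rfl⟩ := fixK x e.1
        obtain ⟨b, rfl⟩ := fixK y e.2
        exact ⟨.some a b (((shortW A B).toAffine.baseChange_nonsingular
          (Algebra.ofId K L).injective a b).1 h), rfl⟩
  · intro P
    constructor
    · rintro ⟨_ | ⟨x, y, h⟩, rfl⟩
      · have e0 : (τ.comp ρ) Point.zero = 0 := map_zero (τ.comp ρ)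
        rw [e0]; rfl
      · obtain ⟨h', e⟩ := hτ _ _ (((shortW (d ^ 2 * A) (d ^ 3 * B)).toAffine.baseChange_nonsingular
          (Algebra.ofId K L).injective x y).2 h)
        have e' : (τ.comp ρ) (.some x y h) = .some _ _ h' := e
        rw [e', Point.neg_some]
        simp only [σm, Point.map_some, Point.some.injEq, negE]
        have c1 : σ (Algebra.ofId K L x) = Algebra.ofId K L x := σ.commutes x
        have c2 : σ (Algebra.ofId K L y) = Algebra.ofId K L y := σ.commutes y
        constructor
        · change σ _ = _
          rw [map_mul, map_pow, map_inv₀, c1, σs, inv_neg]; ring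
        · change σ _ = _
          simp only [map_mul, map_pow, map_inv₀, c2, σs]
          rw [inv_neg]; ring
    · rcases P with _ | ⟨x, y, h⟩
      · intro _; exact ⟨0, by rw [map_zero]; rfl⟩
      · intro e
        rw [Point.neg_some] at e
        simp only [σm, Point.map_some, Point.some.injEq, negE] at e
        obtain ⟨a, rfl⟩ := fixK x e.1
        obtain ⟨b, rfl⟩ := antiK y e.2
        have ns : (WeierstrassCurve.baseChange (shortW (d ^ 2 * A) (d ^ 3 * B)) K).toAffine.Nonsingular
            (d * a) (d ^ 2 * b) := by
          rw [← (shortW (d ^ 2 * A) (d ^ 3 * B)).toAffine.baseChange_nonsingular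
            (Algebra.ofId K L).injective]
          rw [nonsingular_iff, equation_iff] at h ⊢
          simp only [shortW, WeierstrassCurve.baseChange, WeierstrassCurve.map,
            Algebra.ofId_apply, map_zero, map_mul, map_pow, ← hs] at h ⊢
          obtain ⟨h1, h2⟩ := h
          refine ⟨by linear_combination s ^ 6 * h1, ?_⟩
          rcases h2 with h2 | h2
          · left
            intro h
            apply h2
            apply mul_left_cancel₀ (pow_ne_zero 4 s0)
            linear_combination h
          · right
            intro h
            apply h2
            apply mul_left_cancel₀ (pow_ne_zero 3 s0)
            linear_combination h
        refine ⟨.some _ _ ns, ?_⟩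
        obtain ⟨h', e⟩ := hτ _ _ (((shortW (d ^ 2 * A) (d ^ 3 * B)).toAffine.baseChange_nonsingular
          (Algebra.ofId K L).injective _ _).2 ns)
        have e' : (τ.comp ρ) (.some _ _ ns) = .some _ _ h' := e
        rw [e']
        simp only [Point.some.injEq, Algebra.ofId_apply, map_mul, map_pow, ← hs]
        constructor <;> field_simp
end

section
/- Let K be a quadratic number field, E an elliptic curve over K, and L a quadratic extension of K. If E(K)[2] is isomorphic to C_2, then E(L) contains no subgroup isomorphic to C_2 ⊕ C_20. -/
open WeierstrassCurve WeierstrassCurve.Affine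

theorem X20.pow_four_of_mul {A B c : ℤ} (h : IsCoprime A B) (hA : 0 < A) (hAB : A * B = c ^ 4) :
    ∃ p : ℤ, A = p ^ 4 := by
  obtain ⟨d, hd⟩ := exists_associated_pow_of_mul_eq_pow' h hAB
  rcases Int.associated_iff.mp hd with h1 | h1
  · exact ⟨d, h1.symm⟩
  · have : 0 ≤ d ^ 4 := by positivity
    omega

theorem X20.sq_of_mul {A B c : ℤ} (h : IsCoprime A B) (hA : 0 ≤ A) (hAB : A * B = c ^ 2) :
    ∃ p : ℤ, A = p ^ 2 := by
  obtain ⟨d, hd⟩ := exists_associated_pow_of_mul_eq_pow' h hAB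
  rcases Int.associated_iff.mp hd with h1 | h1
  · exact ⟨d, h1.symm⟩
  · have : 0 ≤ d ^ 2 := by positivity
    exact ⟨0, by nlinarith⟩

theorem X20.split5_aux {A B b : ℤ} (h : IsCoprime A B) (hA : 0 < A) (hB : 0 < B)
    (hAB : A * B = 5 * b ^ 4) (h5 : (5 : ℤ) ∣ B) :
    ∃ p q : ℤ, IsCoprime p q ∧ A = p ^ 4 ∧ B = 5 * q ^ 4 ∧ b ^ 2 = p ^ 2 * q ^ 2 := by
  obtain ⟨B', rfl⟩ := h5
  have hB' : 0 < B' := by omega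
  have hco : IsCoprime A B' := h.of_mul_right_right
  have e : A * B' = b ^ 4 := by linarith
  obtain ⟨p, hp⟩ := X20.pow_four_of_mul hco hA e
  obtain ⟨q, hq⟩ := X20.pow_four_of_mul hco.symm hB' (by rw [mul_comm]; exact e)
  refine ⟨p, q, ?_, hp, by rw [hq], ?_⟩
  · rw [hp, hq] at hco
    exact (IsCoprime.pow_iff (by norm_num) (by norm_num)).mp hco
  · have h1 : (b ^ 2) ^ 2 = (p ^ 2 * q ^ 2) ^ 2 := by
      rw [hp, hq] at e
      linear_combination -e
    exact (sq_eq_sq₀ (by positivity) (by positivity)).mp h1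

theorem X20.split5 {A B b : ℤ} (h : IsCoprime A B) (hA : 0 < A) (hB : 0 < B)
    (hAB : A * B = 5 * b ^ 4) :
    ∃ p q : ℤ, IsCoprime p q ∧ A + B = p ^ 4 + 5 * q ^ 4 ∧ b ^ 2 = p ^ 2 * q ^ 2 := by
  have h5 : (5 : ℤ) ∣ A * B := ⟨_, hAB⟩
  have p5 : Prime (5 : ℤ) := Int.prime_ofNat_iff.mpr (by norm_num)
  rcases p5.dvd_or_dvd h5 with h5 | h5
  · obtain ⟨p, q, h1, h2, h3, h4⟩ := X20.split5_aux h.symm hB hA (by rw [mul_comm]; exact hAB) h5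
    exact ⟨p, q, h1, by linarith, h4⟩
  · obtain ⟨p, q, h1, h2, h3, h4⟩ := X20.split5_aux h hA hB hAB h5
    exact ⟨p, q, h1, by linarith, h4⟩

theorem X20.coprime_of_prime {A B : ℤ} (h : ∀ p : ℤ, Prime p → p ∣ A → p ∣ B → False) (h0 : A ≠ 0) :
    IsCoprime A B := by
  refine isCoprime_of_prime_dvd (fun hh => h0 hh.1) (fun p hp ha hb => h p hp ha hb)

theorem X20.sq_mod8 (a : ℤ) : (a % 2 = 0 ∧ (a ^ 2 % 8 = 0 ∨ a ^ 2 % 8 = 4)) ∨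
    (a % 2 = 1 ∧ a ^ 2 % 8 = 1) := by
  have : a % 8 = 0 ∨ a % 8 = 1 ∨ a % 8 = 2 ∨ a % 8 = 3 ∨ a % 8 = 4 ∨ a % 8 = 5 ∨ a % 8 = 6 ∨
    a % 8 = 7 := by omega
  rcases this with h | h | h | h | h | h | h | h <;> 
    [left; right; left; right; left; right; left; right] <;>
    refine ⟨by omega, ?_⟩ <;> simp [pow_two, Int.mul_emod, h]

theorem X20.dvd_of_sq {p b : ℤ} (hp : Prime p) (h : p ^ 2 ∣ 5 * b ^ 4) : p ∣ b := by
  have h4 : p ∣ 5 * b ^ 4 := (dvd_pow_self p two_ne_zero).trans h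
  rcases hp.dvd_or_dvd h4 with h5 | h5
  · obtain ⟨k, hk⟩ := h5
    obtain ⟨l, hl⟩ := h
    have h6 : k * b ^ 4 = p * l := by
      apply mul_left_cancel₀ hp.ne_zero
      rw [← mul_assoc, ← hk, hl]; ring
    rcases hp.dvd_or_dvd (⟨l, h6⟩ : p ∣ k * b ^ 4) with h7 | h7
    · exfalso
      obtain ⟨m, rfl⟩ := h7
      have p5 : Prime (5 : ℤ) := Int.prime_ofNat_iff.mpr (by norm_num)
      rcases p5.irreducible.isUnit_or_isUnit hk with h9 | h9
      · exact hp.not_isUnit h9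
      · exact hp.not_isUnit (isUnit_of_mul_isUnit_left h9)
    · exact hp.dvd_of_dvd_pow h7
  · exact hp.dvd_of_dvd_pow h5

/-- even descent -/
theorem X20.descent_even (ε : ℤ) (hε : ε = 1 ∨ ε = -1) : ∀ (N : ℕ) (a b c : ℤ), b.natAbs = N →
    IsCoprime a b → b % 2 = 0 → c ^ 2 = a ^ 4 + ε * a ^ 2 * b ^ 2 - b ^ 4 → b = 0 := by
  intro N
  induction N using Nat.strong_induction_on with
  | _ N ih =>
  intro a b c hN hco hb heq
  by_contra hb0
  obtain ⟨β, rfl⟩ : ∃ β, b = 2 * β := ⟨b / 2, by omega⟩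
  have hβ : β ≠ 0 := by rintro rfl; simp at hb0
  have hβ2 : 0 < β ^ 2 := by positivity
  have ha : a % 2 = 1 := by
    by_contra h
    have h2a : (2 : ℤ) ∣ a := by omega
    have := hco.isUnit_of_dvd' h2a ⟨β, rfl⟩
    rw [Int.isUnit_iff] at this; omega
  have hε2 : ε ^ 2 = 1 := by rcases hε with rfl | rfl <;> norm_num
  have haβ : IsCoprime a β := hco.of_mul_right_right
  have hS : 0 < a ^ 2 + 2 * ε * β ^ 2 := by
    rcases hε with rfl | rfl
    · positivity
    · by_contra h
      have h1 : 0 ≤ a ^ 2 := by positivity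
      nlinarith [sq_nonneg c, mul_pos hβ2 hβ2, mul_nonneg h1 hβ2.le]
  have hc : c % 2 = 1 := by
    rcases X20.sq_mod8 c with h | h
    · exfalso
      have e : c ^ 2 = a ^ 4 + 4 * (ε * a ^ 2 * β ^ 2 - 4 * β ^ 4) := by rw [heq]; ring
      have e4 : a ^ 4 = (a ^ 2) ^ 2 := by ring
      rcases X20.sq_mod8 a with ha' | ha'
      · omega
      · have h4 := X20.sq_mod8 (a ^ 2)
        generalize ε * a ^ 2 * β ^ 2 - 4 * β ^ 4 = z at e
        omega
    · exact h.1
  have ha2 : a ^ 2 % 2 = 1 := by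
    rcases X20.sq_mod8 a with h | h <;> omega
  obtain ⟨A, hA⟩ : ∃ A, a ^ 2 + 2 * ε * β ^ 2 - c = 2 * A := by
    refine ⟨(a ^ 2 + 2 * ε * β ^ 2 - c) / 2, ?_⟩
    have : 2 * ε * β ^ 2 = 2 * (ε * β ^ 2) := by ring
    omega
  obtain ⟨B, hB⟩ : ∃ B, a ^ 2 + 2 * ε * β ^ 2 + c = 2 * B := ⟨A + c, by linarith⟩
  have hAB : A * B = 5 * β ^ 4 := by
    have : (2 * A) * (2 * B) = 20 * β ^ 4 := by
      rw [← hA, ← hB]; linear_combination -heq + 4 * β ^ 4 * hε2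
    linarith
  have hsum : A + B = a ^ 2 + 2 * ε * β ^ 2 := by linarith
  have hABp : 0 < A * B := by rw [hAB]; positivity
  have hAp : 0 < A := by
    by_contra h
    rcases (pos_iff_pos_of_mul_pos hABp) with ⟨h1, h2⟩
    have : ¬ 0 < B := fun h' => h (h2 h')
    omega
  have hBp : 0 < B := (pos_iff_pos_of_mul_pos hABp).mp hAp
  have hcoAB : IsCoprime A B := by
    refine X20.coprime_of_prime (fun p hp h1 h2 => ?_) hAp.ne'
    have h3 : p ∣ β := X20.dvd_of_sq hp (by rw [← hAB, pow_two]; exact mul_dvd_mul h1 h2)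
    have h4 : p ∣ a := by
      have : p ∣ a ^ 2 := by
        have : a ^ 2 = A + B - β * (2 * ε * β) := by rw [hsum]; ring
        rw [this]
        exact dvd_sub (dvd_add h1 h2) (h3.mul_right _)
      exact hp.dvd_of_dvd_pow this
    exact hp.not_isUnit (haβ.isUnit_of_dvd' h4 h3)
  obtain ⟨p, q, hpq, hs, hb2⟩ := X20.split5 hcoAB hAp hBp hAB
  have hq0 : q ≠ 0 := by rintro rfl; simp at hb2; exact hβ hb2
  have hp0 : p ≠ 0 := by rintro rfl; simp at hb2; exact hβ hb2
  have haa : a ^ 2 = (p ^ 2 - ε * q ^ 2) ^ 2 + (2 * q ^ 2) ^ 2 := by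
    linear_combination -hsum + hs - 2 * ε * hb2 - q ^ 4 * hε2
  have hodd : (p ^ 2 - ε * q ^ 2) % 2 = 1 := by
    rcases X20.sq_mod8 (p ^ 2 - ε * q ^ 2) with h | h
    · exfalso
      have : (2 * q ^ 2) ^ 2 = 4 * q ^ 4 := by ring
      omega
    · exact h.1
  have hpyth : PythagoreanTriple (p ^ 2 - ε * q ^ 2) (2 * q ^ 2) |a| := by
    unfold PythagoreanTriple
    rw [abs_mul_abs_self]; linarith
  have hg : Int.gcd (p ^ 2 - ε * q ^ 2) (2 * q ^ 2) = 1 := by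
    rw [← Int.isCoprime_iff_gcd_eq_one]
    refine IsCoprime.mul_right ?_ ?_
    · refine ⟨1, -((p ^ 2 - ε * q ^ 2) / 2), by omega⟩
    · apply IsCoprime.pow_right
      have : IsCoprime (p ^ 2) q := hpq.pow_left
      have h2 := this.add_mul_right_left (-(ε * q))
      have e : p ^ 2 - ε * q ^ 2 = p ^ 2 + -(ε * q) * q := by ring
      rw [e]; exact h2
  have ha0 : 0 < |a| := abs_pos.mpr (by rintro rfl; simp at ha)
  obtain ⟨m, n, hx, hy, -, hmn, -, hm0⟩ := hpyth.coprime_classification' hg hodd ha0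
  rw [← Int.isCoprime_iff_gcd_eq_one] at hmn
  have hmnq : m * n = q ^ 2 := by linarith
  have hq2 : 0 < q ^ 2 := by positivity
  have hn0 : 0 ≤ n := by
    by_contra h
    nlinarith
  obtain ⟨s, rfl⟩ := X20.sq_of_mul hmn hm0 hmnq
  obtain ⟨t, rfl⟩ := X20.sq_of_mul hmn.symm hn0 (by rw [mul_comm]; exact hmnq)
  have hst : IsCoprime s t := (IsCoprime.pow_iff (by norm_num) (by norm_num)).mp hmn
  have hnew : p ^ 2 = s ^ 4 + ε * s ^ 2 * t ^ 2 - t ^ 4 := by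
    linear_combination hx - ε * hmnq
  have hs0 : s ≠ 0 := by rintro rfl; exact hq2.ne (by simpa using hmnq)
  have ht0 : t ≠ 0 := by rintro rfl; exact hq2.ne (by simpa using hmnq)
  have hteven : t % 2 = 0 := by
    have e1 : s ^ 4 = (s ^ 2) ^ 2 := by ring
    have e2 : t ^ 4 = (t ^ 2) ^ 2 := by ring
    by_contra ht
    have ht1 := X20.sq_mod8 t
    have ht2 := X20.sq_mod8 (t ^ 2)
    have hs1 := X20.sq_mod8 s
    have hs2 := X20.sq_mod8 (s ^ 2)
    have hst1 := X20.sq_mod8 (s * t)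
    have hst0 : (s * t) ^ 2 = s ^ 2 * t ^ 2 := by ring
    have hp1 := X20.sq_mod8 p
    rw [← hmnq] at hodd
    rw [mul_assoc, ← hst0] at hnew
    rw [← hst0] at hodd
    have hse : s % 2 = 0 → (s * t) % 2 = 0 := by
      intro h; rw [Int.mul_emod, h]; simp
    have hso : s % 2 = 1 → (s * t) % 2 = 1 := by
      intro h; rw [Int.mul_emod, h]; have : t % 2 = 1 := by omega
      rw [this]; rfl
    rcases hε with rfl | rfl <;> omega
  have hlt : t.natAbs < N := by
    rw [← hN]
    rw [Int.natAbs_lt_iff_sq_lt]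
    have e : (2 * β) ^ 2 = 4 * (p ^ 2 * s ^ 2) * t ^ 2 := by
      linear_combination 4 * hb2 - 4 * p ^ 2 * hmnq
    rw [e]
    have h1 : 0 < t ^ 2 := by positivity
    have h2 : 0 < p ^ 2 * s ^ 2 := by positivity
    nlinarith
  exact ht0 (ih _ hlt s t p rfl hst hteven hnew)

set_option maxHeartbeats 1000000 in
/-- odd descent -/
theorem X20.descent_odd : ∀ (N : ℕ) (a b c : ℤ), b.natAbs = N →
    IsCoprime a b → a % 2 = 1 → b % 2 = 1 → c ^ 2 = a ^ 4 + a ^ 2 * b ^ 2 - b ^ 4 →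
    a ^ 2 = 1 ∧ b ^ 2 = 1 := by
  intro N
  induction N using Nat.strong_induction_on with
  | _ N ih =>
  intro a b c hN hco ha hb heq
  have hb0 : b ≠ 0 := by rintro rfl; simp at hb
  have ha0 : a ≠ 0 := by rintro rfl; simp at ha
  have hAB : (2 * a ^ 2 + b ^ 2 - 2 * c) * (2 * a ^ 2 + b ^ 2 + 2 * c) = 5 * b ^ 4 := by
    linear_combination -4 * heq
  have hb2 : b ^ 2 % 8 = 1 := by rcases X20.sq_mod8 b with h | h <;> omega
  have hsum0 : 0 < 2 * a ^ 2 + b ^ 2 := by positivity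
  obtain ⟨A, hA⟩ : ∃ A, A = 2 * a ^ 2 + b ^ 2 - 2 * c := ⟨_, rfl⟩
  obtain ⟨B, hB⟩ : ∃ B, B = 2 * a ^ 2 + b ^ 2 + 2 * c := ⟨_, rfl⟩
  rw [← hA, ← hB] at hAB
  have hABp : 0 < A * B := by rw [hAB]; positivity
  have hAp : 0 < A := by
    by_contra h
    rcases (pos_iff_pos_of_mul_pos hABp) with ⟨h1, h2⟩
    have : ¬ 0 < B := fun h' => h (h2 h')
    omega
  have hBp : 0 < B := (pos_iff_pos_of_mul_pos hABp).mp hAp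
  have hcoAB : IsCoprime A B := by
    refine X20.coprime_of_prime (fun p hp h1 h2 => ?_) hAp.ne'
    have h3 : p ∣ b := X20.dvd_of_sq hp (by rw [← hAB, pow_two]; exact mul_dvd_mul h1 h2)
    have h4 : p ∣ a := by
      have h5 : p ∣ 2 * (2 * a ^ 2) := by
        have : 2 * (2 * a ^ 2) = A + B - b * (2 * b) := by rw [hA, hB]; ring
        rw [this]
        exact dvd_sub (dvd_add h1 h2) (h3.mul_right _)
      have h2p : ¬ p ∣ 2 := by
        intro h
        have : p ∣ 1 := by
          have e : (1 : ℤ) = b - 2 * (b / 2) := by omega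
          rw [e]; exact dvd_sub h3 (h.mul_right _)
        exact hp.not_isUnit (isUnit_of_dvd_one this)
      exact hp.dvd_of_dvd_pow
        ((hp.dvd_or_dvd ((hp.dvd_or_dvd h5).resolve_left h2p)).resolve_left h2p)
    exact hp.not_isUnit (hco.isUnit_of_dvd' h4 h3)
  obtain ⟨p, q, hpq, hs, hbpq⟩ := X20.split5 hcoAB hAp hBp hAB
  have hbpq' : b ^ 2 = (p * q) ^ 2 := by rw [hbpq]; ring
  have hpqodd : (p * q) % 2 = 1 := by rcases X20.sq_mod8 (p * q) with h | h <;> omega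
  have hpo : p % 2 = 1 := by
    by_contra h
    have : p % 2 = 0 := by omega
    rw [Int.mul_emod, this] at hpqodd; simp at hpqodd
  have hqo : q % 2 = 1 := by
    by_contra h
    have : q % 2 = 0 := by omega
    rw [Int.mul_emod, this] at hpqodd; simp at hpqodd
  have hq0 : q ≠ 0 := by rintro rfl; simp at hqo
  have hp8 : p ^ 2 % 8 = 1 := by rcases X20.sq_mod8 p with h | h <;> omega
  have hq8 : q ^ 2 % 8 = 1 := by rcases X20.sq_mod8 q with h | h <;> omega
  obtain ⟨k, hk⟩ : ∃ k, p ^ 2 - q ^ 2 = 2 * k := ⟨(p ^ 2 - q ^ 2) / 2, by omega⟩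
  have haa : a ^ 2 = (q ^ 2) ^ 2 + k ^ 2 := by
    have : 4 * a ^ 2 = (p ^ 2 - q ^ 2) ^ 2 + 4 * q ^ 4 := by
      linear_combination hs - hA - hB - 2 * hbpq
    rw [hk] at this
    linarith
  have hpyth : PythagoreanTriple (q ^ 2) k |a| := by
    unfold PythagoreanTriple
    rw [abs_mul_abs_self]; linarith
  have hg : Int.gcd (q ^ 2) k = 1 := by
    rw [← Int.isCoprime_iff_gcd_eq_one]
    apply IsCoprime.pow_left
    have h1 : IsCoprime q (p ^ 2) := hpq.symm.pow_right
    have h2 := h1.add_mul_left_right (-q)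
    have e : p ^ 2 + q * -q = 2 * k := by rw [← hk]; ring
    rw [e] at h2
    exact h2.of_mul_right_right
  obtain ⟨m, n, hx, hy, -, hmn, hpar, hm0⟩ :=
    hpyth.coprime_classification' hg (by omega) (abs_pos.mpr ha0)
  rw [← Int.isCoprime_iff_gcd_eq_one] at hmn
  have hfac : (m + n) * (m - n) = q ^ 2 := by rw [hx]; ring
  have hq2 : 0 < q ^ 2 := by positivity
  have hmp : 0 < m + n := by
    by_contra h
    have : 0 < m - n := by
      by_contra h'
      have : m = 0 ∧ n = 0 := by omega
      rw [this.1, this.2] at hfac; exact hq2.ne (by simpa using hfac)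
    nlinarith
  have hmm : 0 < m - n := (pos_iff_pos_of_mul_pos (by rw [hfac]; exact hq2)).mp hmp
  have hcop : IsCoprime (m + n) (m - n) := by
    refine X20.coprime_of_prime (fun r hr h1 h2 => ?_) hmp.ne'
    have hr2 : ¬ r ∣ 2 := by
      intro h
      have : r ∣ 1 := by
        have e : (1 : ℤ) = (m + n) - 2 * ((m + n) / 2) := by omega
        rw [e]; exact dvd_sub h1 (h.mul_right _)
      exact hr.not_isUnit (isUnit_of_dvd_one this)
    have h3 : r ∣ m := by
      have : r ∣ 2 * m := by
        have e : 2 * m = (m + n) + (m - n) := by ring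
        rw [e]; exact dvd_add h1 h2
      exact (hr.dvd_or_dvd this).resolve_left hr2
    have h4 : r ∣ n := by
      have e : n = (m + n) - m := by ring
      rw [e]; exact dvd_sub h1 h3
    exact hr.not_isUnit (hmn.isUnit_of_dvd' h3 h4)
  obtain ⟨f, hf⟩ := X20.sq_of_mul hcop hmp.le hfac
  obtain ⟨g, hgg⟩ := X20.sq_of_mul hcop.symm hmm.le (by rw [mul_comm]; exact hfac)
  have hfg : IsCoprime f g := by
    rw [hf, hgg] at hcop
    exact (IsCoprime.pow_iff (by norm_num) (by norm_num)).mp hcop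
  have hqfg : q ^ 2 = f ^ 2 * g ^ 2 := by rw [← hfac, hf, hgg]
  have hnew : p ^ 2 = f ^ 4 + f ^ 2 * g ^ 2 - g ^ 4 := by
    have e1 : f ^ 4 = (m + n) ^ 2 := by rw [hf]; ring
    have e2 : g ^ 4 = (m - n) ^ 2 := by rw [hgg]; ring
    rw [e1, e2]
    linear_combination hk + hqfg + 2 * hy
  have hf1 : f % 2 = 1 := by rcases X20.sq_mod8 f with h | h <;> omega
  have hg1 : g % 2 = 1 := by rcases X20.sq_mod8 g with h | h <;> omega
  have hg0 : g ≠ 0 := by rintro rfl; simp at hg1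
  have hf0 : f ≠ 0 := by rintro rfl; simp at hf1
  have hp0 : p ≠ 0 := by rintro rfl; simp at hpo
  have hbig : b ^ 2 = (p * f) ^ 2 * g ^ 2 := by rw [hbpq, hqfg]; ring
  have key : f ^ 2 = 1 ∧ g ^ 2 = 1 := by
    by_cases hlt : g.natAbs < N
    · exact ih _ hlt f g p rfl hfg hf1 hg1 hnew
    · rw [← hN, Int.natAbs_lt_iff_sq_lt, hbig] at hlt
      have h1 : 0 < g ^ 2 := by positivity
      have h2 : 0 < (p * f) ^ 2 := by positivity
      have h3 : (p * f) ^ 2 = 1 := by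
        by_contra h
        have : 2 ≤ (p * f) ^ 2 := by omega
        nlinarith
      have h4 : 0 < p ^ 2 := by positivity
      have h5 : 0 < f ^ 2 := by positivity
      have h6 : p ^ 2 * f ^ 2 = 1 := by rw [← h3]; ring
      have h7 : f ^ 2 = 1 := by
        by_contra h
        have : 2 ≤ f ^ 2 := by omega
        nlinarith
      have h8 : p ^ 2 = 1 := by rw [h7] at h6; linarith
      refine ⟨h7, ?_⟩
      have e : f ^ 4 = (f ^ 2) ^ 2 := by ring
      rw [e, h7, h8] at hnew
      have : g ^ 2 * (g ^ 2 - 1) = 0 := by linarith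
      rcases mul_eq_zero.mp this with h | h
      · omega
      · omega
  obtain ⟨k1, k2⟩ := key
  have e1 : f ^ 4 = (f ^ 2) ^ 2 := by ring
  have e2 : g ^ 4 = (g ^ 2) ^ 2 := by ring
  rw [k1, k2] at hqfg
  rw [e1, e2, k1, k2] at hnew
  have hk0 : k = 0 := by omega
  constructor
  · rw [haa, hk0, hqfg]; norm_num
  · rw [hbpq, hqfg, hnew]; norm_num

set_option maxHeartbeats 1000000 in
/-- `a⁴ + 3a²b² + b⁴` is a square only trivially. -/
theorem X20.descent_three : ∀ (N : ℕ) (a b c : ℤ), (a * b).natAbs = N →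
    IsCoprime a b → c ^ 2 = a ^ 4 + 3 * a ^ 2 * b ^ 2 + b ^ 4 → a * b = 0 := by
  intro N
  induction N using Nat.strong_induction_on with
  | _ N ih =>
  have main : ∀ (a b c : ℤ), (a * b).natAbs = N → a % 2 = 0 →
    IsCoprime a b → c ^ 2 = a ^ 4 + 3 * a ^ 2 * b ^ 2 + b ^ 4 → a * b = 0 := by
    intro a b c hN ha hco heq
    by_contra hab
    have ha0 : a ≠ 0 := left_ne_zero_of_mul hab
    have hb0 : b ≠ 0 := right_ne_zero_of_mul hab
    obtain ⟨α, rfl⟩ : ∃ α, a = 2 * α := ⟨a / 2, by omega⟩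
    have hα0 : α ≠ 0 := by rintro rfl; simp at ha0
    have hb : b % 2 = 1 := by
      by_contra h
      have h2b : (2 : ℤ) ∣ b := by omega
      have := hco.isUnit_of_dvd' ⟨α, rfl⟩ h2b
      rw [Int.isUnit_iff] at this; omega
    have hb2 : b ^ 2 % 8 = 1 := by rcases X20.sq_mod8 b with h | h <;> omega
    have hc0 : c ≠ 0 := by
      rintro rfl
      have : 0 < (2 * α) ^ 4 + 3 * (2 * α) ^ 2 * b ^ 2 + b ^ 4 := by positivity
      simp at heq; linarith
    have hpyth : PythagoreanTriple ((2 * α) ^ 2 + b ^ 2) (2 * α * b) |c| := by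
      unfold PythagoreanTriple
      rw [abs_mul_abs_self]; linear_combination -heq
    have hg : Int.gcd ((2 * α) ^ 2 + b ^ 2) (2 * α * b) = 1 := by
      rw [← Int.isCoprime_iff_gcd_eq_one]
      refine IsCoprime.mul_right ?_ ?_
      · have h1 : IsCoprime (b ^ 2) (2 * α) := hco.symm.pow_left
        have h2 := h1.add_mul_right_left (2 * α)
        have e : (2 * α) ^ 2 + b ^ 2 = b ^ 2 + 2 * α * (2 * α) := by ring
        rw [e]; exact h2
      · have h1 : IsCoprime ((2 * α) ^ 2) b := hco.pow_left
        have h2 := h1.add_mul_right_left b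
        have e : (2 * α) ^ 2 + b ^ 2 = (2 * α) ^ 2 + b * b := by ring
        rw [e]; exact h2
    have hpar : ((2 * α) ^ 2 + b ^ 2) % 2 = 1 := by
      have e : (2 * α) ^ 2 = 4 * α ^ 2 := by ring
      omega
    obtain ⟨u, v, hx, hy, -, huv, -, -⟩ :=
      hpyth.coprime_classification' hg hpar (abs_pos.mpr hc0)
    rw [← Int.isCoprime_iff_gcd_eq_one] at huv
    have huv2 : α * b = u * v := by linarith
    obtain ⟨g, k, ⟨h, rfl⟩, ⟨l, rfl⟩, rfl⟩ := exists_dvd_and_dvd_of_dvd_mul (⟨b, huv2.symm⟩ : α ∣ u * v)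
    have hbe : b = h * l := by
      apply mul_left_cancel₀ hα0; linarith
    subst hbe
    have hg0 : g ≠ 0 := left_ne_zero_of_mul hα0
    have hk0 : k ≠ 0 := right_ne_zero_of_mul hα0
    have hh0 : h ≠ 0 := left_ne_zero_of_mul hb0
    have hl0 : l ≠ 0 := right_ne_zero_of_mul hb0
    have hgl : IsCoprime g l := huv.of_mul_left_left.of_mul_right_right
    have hhk : IsCoprime h k := huv.of_mul_left_right.of_mul_right_left
    have hhl : IsCoprime h l := huv.of_mul_left_right.of_mul_right_right
    have hkl : IsCoprime k l := hco.of_mul_left_right.of_mul_left_right.of_mul_right_right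
    have heqn : l ^ 2 * (h ^ 2 + k ^ 2) = g ^ 2 * (h ^ 2 - 4 * k ^ 2) := by
      linear_combination hx
    have hdv : g ^ 2 ∣ h ^ 2 + k ^ 2 :=
      (hgl.pow (m := 2) (n := 2)).dvd_of_dvd_mul_left ⟨_, heqn⟩
    obtain ⟨j, hj⟩ := hdv
    have hj2 : h ^ 2 - 4 * k ^ 2 = l ^ 2 * j := by
      have : g ^ 2 ≠ 0 := by positivity
      apply mul_left_cancel₀ this
      rw [← heqn, hj]; ring
    have hj0 : 0 < j := by
      have h1 : 0 < g ^ 2 * j := by rw [← hj]; positivity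
      have h2 : 0 < g ^ 2 := by positivity
      exact (pos_iff_pos_of_mul_pos h1).mp h2
    have hj5 : j ∣ 5 := by
      have h1 : j ∣ 5 * h ^ 2 := ⟨4 * g ^ 2 + l ^ 2, by linear_combination 4 * hj + hj2⟩
      have h2 : j ∣ 5 * k ^ 2 := ⟨g ^ 2 - l ^ 2, by linear_combination hj - hj2⟩
      obtain ⟨x, y, hxy⟩ := (hhk.pow (m := 2) (n := 2))
      have e : (5 : ℤ) = x * (5 * h ^ 2) + y * (5 * k ^ 2) := by linear_combination -5 * hxy
      rw [e]; exact dvd_add (h1.mul_left _) (h2.mul_left _)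
    have hho : h % 2 = 1 := by
      by_contra hc
      have : h % 2 = 0 := by omega
      rw [Int.mul_emod, this] at hb; simp at hb
    have hlo : l % 2 = 1 := by
      by_contra hc
      have : l % 2 = 0 := by omega
      rw [Int.mul_emod, this] at hb; simp at hb
    have hh8 : h ^ 2 % 8 = 1 := by rcases X20.sq_mod8 h with h | h <;> omega
    have hl8 : l ^ 2 % 8 = 1 := by rcases X20.sq_mod8 l with h | h <;> omega
    have hj15 : j = 1 ∨ j = 5 := by
      have : j ≤ 5 := Int.le_of_dvd (by norm_num) hj5
      have h1 : j = 1 ∨ j = 2 ∨ j = 3 ∨ j = 4 ∨ j = 5 := by omega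
      rcases h1 with rfl | rfl | rfl | rfl | rfl <;> omega
    rcases hj15 with rfl | rfl
    · have hpy2 : PythagoreanTriple l (2 * k) |h| := by
        unfold PythagoreanTriple
        rw [abs_mul_abs_self]; linear_combination -hj2
      have hg2 : Int.gcd l (2 * k) = 1 := by
        rw [← Int.isCoprime_iff_gcd_eq_one]
        refine IsCoprime.mul_right ⟨1, -(l / 2), by omega⟩ hkl.symm
      obtain ⟨m, n, -, hy2, hz2, hmn, -, -⟩ :=
        hpy2.coprime_classification' hg2 hlo (abs_pos.mpr hh0)
      rw [← Int.isCoprime_iff_gcd_eq_one] at hmn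
      have hk : k = m * n := by linarith
      have hnew : g ^ 2 = m ^ 4 + 3 * m ^ 2 * n ^ 2 + n ^ 4 := by
        have : h ^ 2 = (m ^ 2 + n ^ 2) ^ 2 := by rw [← hz2, sq_abs]
        rw [this, hk] at hj
        linear_combination -hj
      have hlt : (m * n).natAbs < N := by
        rw [← hk, ← hN]
        rw [Int.natAbs_lt_iff_sq_lt]
        have h1 : 0 < k ^ 2 := by positivity
        have h2 : 0 < g ^ 2 * h ^ 2 * l ^ 2 := by positivity
        have e : (2 * (g * k) * (h * l)) ^ 2 = 4 * (g ^ 2 * h ^ 2 * l ^ 2) * k ^ 2 := by ring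
        rw [e]; nlinarith
      exact hk0 (hk.trans (ih _ hlt m n g rfl hmn hnew))
    · have hk8 := X20.sq_mod8 k
      have hg8 := X20.sq_mod8 g
      omega
  intro a b c hN hco heq
  rcases X20.sq_mod8 a with h | h
  · exact main a b c hN h.1 hco heq
  rcases X20.sq_mod8 b with h' | h'
  · rw [mul_comm]
    refine main b a c (by rw [mul_comm]; exact hN) h'.1 hco.symm (by rw [heq]; ring)
  · exfalso
    have e1 : a ^ 4 = (a ^ 2) ^ 2 := by ring
    have e2 : b ^ 4 = (b ^ 2) ^ 2 := by ring
    have e3 : 3 * a ^ 2 * b ^ 2 = 3 * (a * b) ^ 2 := by ring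
    rw [e1, e2, e3] at heq
    have h1 := X20.sq_mod8 (a ^ 2)
    have h2 := X20.sq_mod8 (b ^ 2)
    have h3 := X20.sq_mod8 (a * b)
    have h4 := X20.sq_mod8 c
    have h5 : (a * b) % 2 = 1 := by rw [Int.mul_emod, h.1, h'.1]; rfl
    omega

theorem X20.descent_neg {a b c : ℤ} (hco : IsCoprime a b)
    (heq : -c ^ 2 = a ^ 4 - 3 * a ^ 2 * b ^ 2 + b ^ 4) : a ^ 2 = b ^ 2 := by
  have hpar : a % 2 = 1 ∧ b % 2 = 1 := by
    have e1 : a ^ 4 = (a ^ 2) ^ 2 := by ring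
    have e2 : b ^ 4 = (b ^ 2) ^ 2 := by ring
    have e3 : 3 * a ^ 2 * b ^ 2 = 3 * (a * b) ^ 2 := by ring
    rw [e1, e2, e3] at heq
    have h1 := X20.sq_mod8 (a ^ 2)
    have h2 := X20.sq_mod8 (b ^ 2)
    have h3 := X20.sq_mod8 (a * b)
    have h4 := X20.sq_mod8 c
    have h6 := X20.sq_mod8 a
    have h7 := X20.sq_mod8 b
    have h5 : a % 2 = 0 → (a * b) % 2 = 0 := by intro h; rw [Int.mul_emod, h]; simp
    have h5' : b % 2 = 0 → (a * b) % 2 = 0 := by intro h; rw [Int.mul_emod, h]; simp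
    have h8 : ¬ (a % 2 = 0 ∧ b % 2 = 0) := by
      rintro ⟨ha, hb⟩
      have := hco.isUnit_of_dvd' (Int.dvd_of_emod_eq_zero ha) (Int.dvd_of_emod_eq_zero hb)
      rw [Int.isUnit_iff] at this; omega
    omega
  have ha8 := X20.sq_mod8 a
  have hb8 := X20.sq_mod8 b
  have hcc : c ^ 2 + (a ^ 2 - b ^ 2) ^ 2 = (a * b) ^ 2 := by linear_combination -heq
  have hco1 : IsCoprime ((a * b) ^ 2) (a ^ 2 - b ^ 2) := by
    apply IsCoprime.pow_left
    refine IsCoprime.mul_left ?_ ?_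
    · have h1 : IsCoprime a (-b ^ 2) := (hco.pow_right (n := 2)).neg_right
      have h2 := h1.add_mul_left_right a
      have e : a ^ 2 - b ^ 2 = -b ^ 2 + a * a := by ring
      rw [e]; exact h2
    · have h1 : IsCoprime b (a ^ 2) := hco.symm.pow_right
      have h2 := h1.add_mul_left_right (-b)
      have e : a ^ 2 - b ^ 2 = a ^ 2 + b * -b := by ring
      rw [e]; exact h2
  have hco2 : IsCoprime c (a ^ 2 - b ^ 2) := by
    have h := hco1.add_mul_right_left (-(a ^ 2 - b ^ 2))
    have e : (a * b) ^ 2 + -(a ^ 2 - b ^ 2) * (a ^ 2 - b ^ 2) = c ^ 2 := by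
      linear_combination -hcc
    rw [e] at h
    exact (IsCoprime.pow_left_iff (by norm_num)).mp h
  have hodd : c % 2 = 1 := by
    by_contra h
    have := hco2.isUnit_of_dvd' (x := 2) (by omega) (by omega)
    rw [Int.isUnit_iff] at this; omega
  have hpyth : PythagoreanTriple c (a ^ 2 - b ^ 2) |a * b| := by
    unfold PythagoreanTriple
    rw [abs_mul_abs_self]; linear_combination hcc
  have hab0 : a * b ≠ 0 := by
    refine mul_ne_zero ?_ ?_
    · rintro rfl; simp at hpar
    · rintro rfl; simp at hpar
  obtain ⟨u, v, -, hy, hz, huv, -, -⟩ := hpyth.coprime_classification'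
    (Int.isCoprime_iff_gcd_eq_one.mp hco2) hodd (abs_pos.mpr hab0)
  rw [← Int.isCoprime_iff_gcd_eq_one] at huv
  obtain ⟨k, hk⟩ : ∃ k, a ^ 2 + b ^ 2 = 2 * k := ⟨(a ^ 2 + b ^ 2) / 2, by omega⟩
  have hz2 : (a * b) ^ 2 = (u ^ 2 + v ^ 2) ^ 2 := by rw [← hz, sq_abs]
  have hnew : k ^ 2 = u ^ 4 + 3 * u ^ 2 * v ^ 2 + v ^ 4 := by
    have : (2 * k) ^ 2 = 4 * (u ^ 4 + 3 * u ^ 2 * v ^ 2 + v ^ 4) := by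
      rw [← hk]
      linear_combination 4 * hz2 + (a ^ 2 - b ^ 2 + 2 * u * v) * hy
    linarith
  have h0 := X20.descent_three _ u v k rfl huv hnew
  have : 2 * u * v = 0 := by rw [mul_assoc, h0]; rfl
  linarith

theorem X20.rat_param (k d : ℤ) (hd : d = 1 ∨ d = -1) (x m : ℚ)
    (h : m ^ 2 = x * (x ^ 2 + k * x + d)) (hx : x ≠ 0) :
    ∃ a b c e : ℤ, (e = 1 ∨ e = -1) ∧ a ≠ 0 ∧ b ≠ 0 ∧ IsCoprime a b ∧
      x = e * (a : ℚ) ^ 2 / (b : ℚ) ^ 2 ∧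
      e * c ^ 2 = a ^ 4 + k * e * a ^ 2 * b ^ 2 + d * b ^ 4 := by
  obtain ⟨r, hr⟩ : ∃ r : ℤ, r = x.num := ⟨_, rfl⟩
  obtain ⟨s, hs⟩ : ∃ s : ℤ, s = x.den := ⟨_, rfl⟩
  have hs0 : 0 < s := by rw [hs]; exact_mod_cast x.den_pos
  have hsq : (s : ℚ) ≠ 0 := by exact_mod_cast hs0.ne'
  have hxrs : x = r / s := by rw [hr, hs]; exact_mod_cast (Rat.num_div_den x).symm
  have hr0 : r ≠ 0 := by rw [hr]; exact Rat.num_ne_zero.mpr hx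
  have hco : IsCoprime r s := by
    rw [hr, hs, Int.isCoprime_iff_gcd_eq_one]
    exact x.reduced
  obtain ⟨q, hq⟩ : ∃ q, q = r ^ 2 + k * r * s + d * s ^ 2 := ⟨_, rfl⟩
  have hsqr : IsSquare ((r * s * q : ℤ) : ℚ) := by
    refine ⟨m * s ^ 2, ?_⟩
    have : m * s ^ 2 * (m * s ^ 2) = m ^ 2 * s ^ 4 := by ring
    rw [this, h, hxrs, hq]
    push_cast
    field_simp
  obtain ⟨M, hM⟩ := Rat.isSquare_intCast_iff.mp hsqr
  have hd2 : d * d = 1 := by rcases hd with rfl | rfl <;> norm_num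
  have hrq : IsCoprime r q := by
    have h1 : IsCoprime r (d * s ^ 2) :=
      IsCoprime.mul_right ⟨0, d, by linarith⟩ hco.pow_right
    have h2 := h1.add_mul_left_right (r + k * s)
    have e : q = d * s ^ 2 + r * (r + k * s) := by rw [hq]; ring
    rw [e]; exact h2
  have hsq' : IsCoprime s q := by
    have h1 : IsCoprime s (r ^ 2) := hco.symm.pow_right
    have h2 := h1.add_mul_left_right (k * r + d * s)
    have e : q = r ^ 2 + s * (k * r + d * s) := by rw [hq]; ring
    rw [e]; exact h2
  obtain ⟨b, hb⟩ := X20.sq_of_mul (hco.symm.mul_right hsq') hs0.le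
    (by rw [pow_two, ← hM]; ring : s * (r * q) = M ^ 2)
  obtain ⟨e, he, hep⟩ : ∃ e : ℤ, (e = 1 ∨ e = -1) ∧ 0 < e * r := by
    rcases lt_or_gt_of_ne hr0 with h | h
    · exact ⟨-1, Or.inr rfl, by linarith⟩
    · exact ⟨1, Or.inl rfl, by linarith⟩
  have he2 : e * e = 1 := by rcases he with rfl | rfl <;> norm_num
  have hcoe : IsCoprime (e * r) (e * (s * q)) := by
    refine IsCoprime.mul_left ⟨e, 0, by linarith⟩ (IsCoprime.mul_right ⟨0, e, by linarith⟩ ?_)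
    exact hco.mul_right hrq
  obtain ⟨a, ha⟩ := X20.sq_of_mul hcoe hep.le
    (by rw [pow_two, ← hM]; linear_combination r * s * q * he2 : e * r * (e * (s * q)) = M ^ 2)
  have ha' : r = e * a ^ 2 := by rw [← ha, ← mul_assoc, he2, one_mul]
  have ha0 : a ≠ 0 := by rintro rfl; simp at ha'; exact hr0 ha'
  have hb0 : b ≠ 0 := by rintro rfl; simp at hb; omega
  have hdvd : (a * b) ^ 2 ∣ M ^ 2 := by
    refine ⟨e * q, ?_⟩
    rw [pow_two M, ← hM, ha', hb]; ring
  obtain ⟨c, hc⟩ := (Int.pow_dvd_pow_iff two_ne_zero).mp hdvd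
  refine ⟨a, b, c, e, he, ha0, hb0, ?_, ?_, ?_⟩
  · rw [hb, ha'] at hco
    have := hco.of_mul_left_right
    exact (IsCoprime.pow_iff (by norm_num) (by norm_num)).mp this
  · rw [hxrs, ha', hb]; push_cast; rfl
  · have h1 : (a * b) ^ 2 * (e * c ^ 2) = (a * b) ^ 2 * q := by
      have : M * M = (a * b) ^ 2 * c ^ 2 := by rw [hc]; ring
      rw [← hM, ha', hb] at this
      linear_combination -e * this + (a * b) ^ 2 * q * he2
    have h2 : (a * b) ^ 2 ≠ 0 := pow_ne_zero _ (mul_ne_zero ha0 hb0)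
    have h3 := mul_left_cancel₀ h2 h1
    rw [h3, hq, ha', hb]
    linear_combination a ^ 4 * he2

/-- Points on `m² = x³ - x² - x`. -/
theorem X20.rat_A (x m : ℚ) (h : m ^ 2 = x * (x ^ 2 - x - 1)) : x = 0 := by
  by_contra hx
  obtain ⟨a, b, c, e, he, ha, hb, hco, -, heq⟩ := X20.rat_param (-1) (-1) (Or.inr rfl) x m
    (by rw [h]; push_cast; ring) hx
  have key : ∀ a b c : ℤ, IsCoprime a b → c ^ 2 = a ^ 4 + (-1) * a ^ 2 * b ^ 2 - b ^ 4 → b = 0 := by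
    intro a b c hco h
    refine X20.descent_even (-1) (Or.inr rfl) _ a b c rfl hco ?_ h
    by_contra hb
    have e1 : a ^ 4 = (a ^ 2) ^ 2 := by ring
    have e2 : b ^ 4 = (b ^ 2) ^ 2 := by ring
    have e3 : (-1) * a ^ 2 * b ^ 2 = - (a * b) ^ 2 := by ring
    rw [e1, e2, e3] at h
    have h1 := X20.sq_mod8 (a ^ 2)
    have h2 := X20.sq_mod8 (b ^ 2)
    have h3 := X20.sq_mod8 (a * b)
    have h4 := X20.sq_mod8 c
    have h6 := X20.sq_mod8 a
    have h7 := X20.sq_mod8 b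
    have h5 : a % 2 = 0 → (a * b) % 2 = 0 := by intro h; rw [Int.mul_emod, h]; simp
    have h5' : a % 2 = 1 → (a * b) % 2 = 1 := by
      intro h; rw [Int.mul_emod, h, (by omega : b % 2 = 1)]; rfl
    omega
  rcases he with rfl | rfl
  · exact hb (key a b c hco (by linear_combination heq))
  · exact ha (key b a c hco.symm (by linear_combination -heq))

/-- Points on `m² = x³ + x² - x`. -/
theorem X20.rat_B (x m : ℚ) (h : m ^ 2 = x * (x ^ 2 + x - 1)) : x = 0 ∨ x = 1 ∨ x = -1 := by
  by_cases hx : x = 0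
  · exact Or.inl hx
  obtain ⟨a, b, c, e, he, ha, hb, hco, hxe, heq⟩ := X20.rat_param 1 (-1) (Or.inr rfl) x m
    (by rw [h]; push_cast; ring) hx
  have key : ∀ a b c : ℤ, IsCoprime a b → b ≠ 0 → c ^ 2 = a ^ 4 + 1 * a ^ 2 * b ^ 2 - b ^ 4 →
      a ^ 2 = 1 ∧ b ^ 2 = 1 := by
    intro a b c hco hb0 h
    have hb : b % 2 = 1 := by
      by_contra hb
      exact hb0 (X20.descent_even 1 (Or.inl rfl) _ a b c rfl hco (by omega) h)
    refine X20.descent_odd _ a b c rfl hco ?_ hb (by rw [h]; ring)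
    by_contra ha
    have e1 : a ^ 4 = (a ^ 2) ^ 2 := by ring
    have e2 : b ^ 4 = (b ^ 2) ^ 2 := by ring
    have e3 : 1 * a ^ 2 * b ^ 2 = (a * b) ^ 2 := by ring
    rw [e1, e2, e3] at h
    have h1 := X20.sq_mod8 (a ^ 2)
    have h2 := X20.sq_mod8 (b ^ 2)
    have h3 := X20.sq_mod8 (a * b)
    have h4 := X20.sq_mod8 c
    have h6 := X20.sq_mod8 a
    have h7 := X20.sq_mod8 b
    have h5 : a % 2 = 0 → (a * b) % 2 = 0 := by intro h; rw [Int.mul_emod, h]; simp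
    omega
  have hab : a ^ 2 = 1 ∧ b ^ 2 = 1 := by
    rcases he with rfl | rfl
    · exact key a b c hco hb (by linear_combination heq)
    · exact (key b a c hco.symm ha (by linear_combination -heq)).symm
  have ha2 : (a : ℚ) ^ 2 = 1 := by exact_mod_cast hab.1
  have hb2 : (b : ℚ) ^ 2 = 1 := by exact_mod_cast hab.2
  rw [ha2, hb2] at hxe
  rcases he with rfl | rfl
  · right; left; simpa using hxe
  · right; right; simpa using hxe

/-- Points on `m² = x³ + 3x² + x`. -/
theorem X20.rat_C (x m : ℚ) (h : m ^ 2 = x * (x ^ 2 + 3 * x + 1)) : x = 0 ∨ x = -1 := by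
  by_cases hx : x = 0
  · exact Or.inl hx
  obtain ⟨a, b, c, e, he, ha, hb, hco, hxe, heq⟩ := X20.rat_param 3 1 (Or.inl rfl) x m
    (by rw [h]; push_cast; ring) hx
  rcases he with rfl | rfl
  · exact absurd (X20.descent_three _ a b c rfl hco (by linear_combination heq))
      (mul_ne_zero ha hb)
  · have h1 := X20.descent_neg hco (c := c) (by linear_combination heq)
    right
    have h2 : (a : ℚ) ^ 2 = (b : ℚ) ^ 2 := by exact_mod_cast h1
    have hbq : (b : ℚ) ^ 2 ≠ 0 := by positivity
    rw [hxe, h2]; push_cast; field_simp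

theorem X20.exists_conj (F E : Type*) [Field F] [Field E] [Algebra F E] [CharZero F]
    (h : Module.finrank F E = 2) :
    ∃ σ : E →ₐ[F] E, (∀ x, σ (σ x) = x) ∧ (∀ x, σ x = x → ∃ a, algebraMap F E a = x) := by
  haveI : Algebra.IsQuadraticExtension F E := ⟨h⟩
  haveI : FiniteDimensional F E := FiniteDimensional.of_finrank_pos (by omega)
  haveI : IsGalois F E := inferInstance
  have hcard : Nat.card (E ≃ₐ[F] E) = 2 := by rw [IsGalois.card_aut_eq_finrank, h]
  obtain ⟨σ, τ, hne, huniv⟩ := Nat.card_eq_two_iff.mp hcard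
  obtain ⟨ρ, hρ1, hρ⟩ : ∃ ρ : E ≃ₐ[F] E, ρ ≠ 1 ∧ ∀ g : E ≃ₐ[F] E, g = 1 ∨ g = ρ := by
    have h1 : (1 : E ≃ₐ[F] E) ∈ ({σ, τ} : Set _) := by rw [huniv]; trivial
    rcases h1 with h1 | h1
    · refine ⟨τ, by rw [h1]; exact hne.symm, fun g => ?_⟩
      have : g ∈ ({σ, τ} : Set _) := by rw [huniv]; trivial
      rw [h1]; exact this
    · have h1' : (1 : E ≃ₐ[F] E) = τ := h1
      refine ⟨σ, by rw [h1']; exact hne, fun g => ?_⟩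
      have : g ∈ ({σ, τ} : Set _) := by rw [huniv]; trivial
      rw [h1']; exact this.symm
  refine ⟨(ρ : E →ₐ[F] E), fun x => ?_, fun x hx => ?_⟩
  · have h2 : ρ * ρ = 1 := by
      rcases hρ (ρ * ρ) with h | h
      · exact h
      · exact absurd (mul_eq_left.mp h) hρ1
    have := DFunLike.congr_fun h2 x
    simpa using this
  · have := (IsGalois.mem_bot_iff_fixed (F := F) (E := E) x).mpr (fun g => by
      rcases hρ g with rfl | rfl
      · rfl
      · exact hx)
    exact IntermediateField.mem_bot.mp this

theorem X20.quadratic_points {K : Type*} [Field K] [NumberField K] (hK : Module.finrank ℚ K = 2)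
    (X S : K) (h : S ^ 4 = X * (X ^ 2 + X - 1)) : X = 0 ∨ X = 1 ∨ X = -1 ∨ S = 0 := by
  obtain ⟨σ, hσσ, hfix⟩ := X20.exists_conj ℚ K hK
  have inj : Function.Injective (algebraMap ℚ K) := (algebraMap ℚ K).injective
  have hfix' : ∀ x, σ x = x → ∃ a : ℚ, (a : K) = x := by
    intro x hx
    obtain ⟨a, ha⟩ := hfix x hx
    exact ⟨a, by rw [← ha]; simp⟩
  obtain ⟨V, hV⟩ : ∃ V, V = S ^ 2 := ⟨_, rfl⟩
  have hV2 : V ^ 2 = X * (X ^ 2 + X - 1) := by rw [hV, ← h]; ring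
  obtain ⟨M, hM⟩ := hfix' (S * σ S) (by rw [map_mul, hσσ, mul_comm])
  have hN : V * σ V = (M : K) ^ 2 := by rw [hM, hV, map_pow]; ring
  by_cases hX : σ X = X
  · obtain ⟨x, hx⟩ := hfix' X hX
    have hsV : σ V ^ 2 = V ^ 2 := by
      rw [← map_pow, hV2]; simp [hX]
    rcases sq_eq_sq_iff_eq_or_eq_neg.mp hsV with h1 | h1
    · obtain ⟨v, hv⟩ := hfix' V h1
      have : v ^ 2 = x * (x ^ 2 + x - 1) := by
        rw [← hv, ← hx] at hV2; exact_mod_cast hV2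
      rcases X20.rat_B x v this with h | h | h
      · left; rw [← hx, h]; simp
      · right; left; rw [← hx, h]; simp
      · right; right; left; rw [← hx, h]; simp
    · have : M ^ 2 = (-x) * ((-x) ^ 2 - (-x) - 1) := by
        have : (M : K) ^ 2 = (-x) * ((-x) ^ 2 - (-x) - 1) := by
          rw [← hN, h1, hx]; linear_combination -hV2
        exact_mod_cast this
      have h0 := X20.rat_A _ _ this
      left; rw [← hx, neg_eq_zero.mp h0]; simp
  · have hd : X - σ X ≠ 0 := fun h => hX (sub_eq_zero.mp h).symm
    have hd' : σ X - X ≠ 0 := fun h => hX (sub_eq_zero.mp h)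
    obtain ⟨e, he⟩ := hfix' ((V - σ V) / (X - σ X)) (by
      rw [map_div₀, map_sub, map_sub, hσσ, hσσ]; field_simp; ring)
    obtain ⟨f, hf⟩ := hfix' (V - e * X) (by
      have : σ (e : K) = e := by simp
      rw [map_sub, map_mul, this, he]; field_simp; ring)
    have hVe : V = e * X + f := by rw [hf]; ring
    have hsV : σ V = e * σ X + f := by rw [hVe]; simp
    obtain ⟨a, ha⟩ := hfix' (X + σ X) (by rw [map_add, hσσ, add_comm])
    obtain ⟨b, hb⟩ := hfix' (X * σ X) (by rw [map_mul, hσσ, mul_comm])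
    have hV2' : σ V ^ 2 = σ X * (σ X ^ 2 + σ X - 1) := by
      rw [← map_pow, hV2]; simp
    have hb1 : σ X = a - X := by rw [ha]; ring
    have hXX : X ^ 2 = a * X - b := by rw [ha, hb]; ring
    have r1K : (1 + 2 * e * f : K) = -b - (e ^ 2 - 1 - a) * a := by
      have : (X - σ X) * ((1 + 2 * e * f : K) - (-b - (e ^ 2 - 1 - a) * a)) = 0 := by
        rw [ha, hb]
        rw [hVe] at hV2
        rw [hsV] at hV2'
        linear_combination hV2 - hV2'
      rcases mul_eq_zero.mp this with h | h
      · exact absurd h hd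
      · exact sub_eq_zero.mp h
    have r2K : (f ^ 2 : K) = b * (e ^ 2 - 1 - a) := by
      rw [hVe] at hV2
      linear_combination hV2 - X * r1K + (X + a - (e ^ 2 - 1)) * hXX
    have r3K : (M ^ 2 : K) = e ^ 2 * b + e * f * a + f ^ 2 := by
      rw [← hN, hsV, hVe, ha, hb]; ring
    have r1 : 1 + 2 * e * f = -b - (e ^ 2 - 1 - a) * a := by exact_mod_cast r1K
    have r2 : f ^ 2 = b * (e ^ 2 - 1 - a) := by exact_mod_cast r2K
    have r3 : M ^ 2 = e ^ 2 * b + e * f * a + f ^ 2 := by exact_mod_cast r3K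
    have hb0 : b = 0 → X = 0 := by
      intro h0
      rw [h0] at hb
      have : X * σ X = 0 := by rw [← hb]; simp
      rcases mul_eq_zero.mp this with h | h
      · exact h
      · have := hσσ X; rw [h] at this; simpa using this.symm
    obtain ⟨z, hz⟩ : ∃ z, z = e ^ 2 - 1 - a := ⟨_, rfl⟩
    rw [← hz] at r1 r2
    have hpt : (e * z + f) ^ 2 = z * (z ^ 2 + z - 1) := by
      have ha' : a = e ^ 2 - 1 - z := by linarith
      rw [ha'] at r1
      linear_combination r2 + z * r1
    rcases X20.rat_B z _ hpt with hz0 | hz0 | hz0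
    · rw [hz0] at r1 r2
      have hf0 : f = 0 := by simpa using r2
      rw [hf0] at r1 r3
      have hbb : b = -1 := by linarith
      rw [hbb] at r3
      have he0 : e = 0 := by nlinarith [sq_nonneg M, sq_nonneg e]
      right; right; right
      have : V = 0 := by rw [hVe, he0, hf0]; simp
      rw [hV] at this
      exact pow_eq_zero_iff (two_ne_zero) |>.mp this
    · rw [hz0] at r1 r2 hz
      have ha' : a = e ^ 2 - 2 := by linarith
      have hb' : b = f ^ 2 := by linarith
      have h1 : (e + f) ^ 2 = 1 := by rw [ha', hb'] at r1; linear_combination r1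
      obtain ⟨ε, hε⟩ : ∃ ε, ε = e + f := ⟨_, rfl⟩
      rw [← hε] at h1
      have hf' : f = ε - e := by linarith
      have h2 : M ^ 2 = (1 - ε * e) * ((1 - ε * e) ^ 2 + (1 - ε * e) - 1) := by
        rw [r3, ha', hb', hf']
        linear_combination (1 - 3 * e ^ 2 + ε * e ^ 3) * h1
      rcases X20.rat_B _ _ h2 with h3 | h3 | h3
      · left; apply hb0; rw [hb', hf']
        have : ε - e = ε * (1 - ε * e) + e * (ε ^ 2 - 1) := by ring
        rw [this, h3, h1]; ring
      · have he0 : e = 0 := by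
          have : e = ε * (ε * e) - e * (ε ^ 2 - 1) := by ring
          rw [this, h1, (by linarith : ε * e = 0)]; ring
        right; right; left
        rw [ha', hb', hf', he0, sub_zero, h1] at hXX
        have : (X + 1) ^ 2 = 0 := by push_cast at hXX; linear_combination hXX
        exact eq_neg_of_add_eq_zero_left (pow_eq_zero_iff two_ne_zero |>.mp this)
      · have hεe : ε * e = 2 := by linarith
        have he2 : e ^ 2 = 4 := by
          have : e ^ 2 = (ε * e) ^ 2 - e ^ 2 * (ε ^ 2 - 1) := by ring
          rw [this, h1, hεe]; ring
        have hf2 : f ^ 2 = 1 := by rw [hf']; linear_combination h1 - 2 * hεe + he2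
        right; left
        rw [ha', hb', hf2, he2] at hXX
        have : (X - 1) ^ 2 = 0 := by push_cast at hXX; linear_combination hXX
        exact sub_eq_zero.mp (pow_eq_zero_iff two_ne_zero |>.mp this)
    · rw [hz0] at r1 r2 hz
      have ha' : a = e ^ 2 := by linarith
      have hb' : b = -f ^ 2 := by linarith
      have h1 : (f - e) ^ 2 = 1 := by rw [ha', hb'] at r1; linear_combination -r1
      obtain ⟨ε, hε⟩ : ∃ ε, ε = f - e := ⟨_, rfl⟩
      rw [← hε] at h1
      have hf' : f = ε + e := by linarith
      have h2 : M ^ 2 = (-(1 + ε * e)) * ((-(1 + ε * e)) ^ 2 + 3 * (-(1 + ε * e)) + 1) := by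
        rw [r3, ha', hb', hf']
        linear_combination (1 + ε * e ^ 3 - e ^ 2) * h1
      rcases X20.rat_C _ _ h2 with h3 | h3
      · left; apply hb0; rw [hb', hf']
        have : ε + e = ε * (1 + ε * e) - e * (ε ^ 2 - 1) := by ring
        rw [this, (by linarith : 1 + ε * e = 0), h1]; ring
      · have he0 : e = 0 := by
          have : e = ε * (ε * e) - e * (ε ^ 2 - 1) := by ring
          rw [this, h1, (by linarith : ε * e = 0)]; ring
        rw [ha', hb', hf', he0, add_zero, h1] at hXX
        have : (X - 1) * (X + 1) = 0 := by push_cast at hXX; linear_combination hXX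
        rcases mul_eq_zero.mp this with h | h
        · right; left; exact sub_eq_zero.mp h
        · right; right; left; exact eq_neg_of_add_eq_zero_left h

/-- From the data of a point of order 20 to a point on `S⁴ = X³ + X² - X`. -/
theorem X20.param {K : Type*} [Field K] [CharZero K] (t x c s : K) (ht : t ≠ 0) (hx : x ≠ 0)
    (hs : s ≠ 0)
    (h1 : t ^ 2 * (x + 1) ^ 2 - 2 * t * x * (3 * x + 1) + x ^ 2 * (4 * x + 1) = 0)
    (h2 : 2 * c ^ 2 = 6 * x ^ 2 + (t ^ 2 - 6 * t + 1) * x + (t ^ 2 - t))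
    (h3 : 4 * s ^ 2 = 12 * x + (t ^ 2 - 6 * t + 1) + 8 * c) :
    ∃ X S : K, S ^ 4 = X * (X ^ 2 + X - 1) ∧ X ≠ 0 ∧ X ≠ 1 ∧ X ≠ -1 ∧ S ≠ 0 := by
  have two : (2 : K) ≠ 0 := two_ne_zero
  obtain ⟨w, hw⟩ : ∃ w, w = (t * (x + 1) ^ 2 - x * (3 * x + 1)) / (2 * x ^ 2) := ⟨_, rfl⟩
  have hwx : 2 * x ^ 2 * w = t * (x + 1) ^ 2 - x * (3 * x + 1) := by rw [hw]; field_simp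
  have hw2 : x = -w ^ 2 := by
    have : 4 * x ^ 4 * (x + w ^ 2) = 0 := by
      linear_combination (2 * x ^ 2 * w + (t * (x + 1) ^ 2 - x * (3 * x + 1))) * hwx
        + (x + 1) ^ 2 * h1
    have h4 : (4 : K) * x ^ 4 ≠ 0 := mul_ne_zero (by norm_num) (pow_ne_zero _ hx)
    have := (mul_eq_zero.mp this).resolve_left h4
    linear_combination this
  have hw0 : w ≠ 0 := by rintro rfl; simp at hw2; exact hx hw2
  have hw1 : 1 - w ≠ 0 := by
    intro h
    have hw1 : w = 1 := by linear_combination -h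
    rw [hw2, hw1] at hwx
    norm_num at hwx
  have htw : t * (1 - w) ^ 2 = w ^ 2 * (2 * w - 1) := by
    by_cases hm : 1 + w = 0
    · have hm' : w = -1 := by linear_combination hm
      rw [hw2, hm'] at h1
      rw [hm']
      linear_combination -h1
    · rw [hw2] at hwx
      have : (1 + w) ^ 2 * (t * (1 - w) ^ 2 - w ^ 2 * (2 * w - 1)) = 0 := by
        linear_combination -hwx
      exact sub_eq_zero.mp ((mul_eq_zero.mp this).resolve_left (pow_ne_zero _ hm))
  have hwh : 2 * w - 1 ≠ 0 := by
    intro h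
    rw [h, mul_zero] at htw
    rcases mul_eq_zero.mp htw with h | h
    · exact ht h
    · exact hw1 (pow_eq_zero_iff two_ne_zero |>.mp h)
  have htw' : t = w ^ 2 * (2 * w - 1) / (1 - w) ^ 2 := by
    rw [eq_div_iff (pow_ne_zero _ hw1)]; exact htw
  obtain ⟨y, hy⟩ : ∃ y, y = c * (1 - w) ^ 2 / w ^ 2 := ⟨_, rfl⟩
  have hc : c = w ^ 2 * y / (1 - w) ^ 2 := by rw [hy]; field_simp
  have hyy : y ^ 2 = (w ^ 2 - 2 * w) ^ 2 - w := by
    have hy' : c * (1 - w) ^ 2 = w ^ 2 * y := by rw [hy]; field_simp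
    rw [hw2] at h2
    have h4 : (2 : K) * w ^ 4 ≠ 0 := mul_ne_zero two (pow_ne_zero _ hw0)
    apply mul_left_cancel₀ h4
    have e1 : 2 * (c * (1 - w) ^ 2) ^ 2 = 6 * w ^ 4 * (1 - w) ^ 4
        - w ^ 2 * ((t * (1 - w) ^ 2) ^ 2 - 6 * (t * (1 - w) ^ 2) * (1 - w) ^ 2 + (1 - w) ^ 4)
        + (t * (1 - w) ^ 2) ^ 2 - (t * (1 - w) ^ 2) * (1 - w) ^ 2 := by
      linear_combination (1 - w) ^ 4 * h2
    rw [hy', htw] at e1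
    linear_combination e1
  have hF : (2 * s * (1 - w) ^ 2) ^ 2 = 1 - 4 * w + 20 * w ^ 3 - 40 * w ^ 4 + 32 * w ^ 5
      - 8 * w ^ 6 + 8 * w ^ 2 * (1 - w) ^ 2 * y := by
    have : (2 * s * (1 - w) ^ 2) ^ 2 = (4 * s ^ 2) * (1 - w) ^ 4 := by ring
    rw [this, h3, hc, hw2, htw']
    field_simp
    ring
  obtain ⟨X, hX⟩ : ∃ X, X = 2 * (w ^ 2 - 2 * w + y) + 1 := ⟨_, rfl⟩
  obtain ⟨Y, hY⟩ : ∃ Y, Y = 2 * w * X - 2 * w - 2 * X + 1 := ⟨_, rfl⟩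
  have hYY : Y ^ 2 = X * (X ^ 2 + X - 1) := by
    rw [hY, hX]
    linear_combination (16 * w - 8 * w ^ 2 - 8 * y) * hyy
  have hFh : (2 * s * (1 - w) ^ 2) ^ 2 * (Y - 2 * X + 1) ^ 2 = -4 * Y * X ^ 2 := by
    rw [hF, hY, hX]
    linear_combination (-16 + 128 * w - 48 * w ^ 2 - 1280 * w ^ 3 + 3840 * w ^ 4 - 4928 * w ^ 5
      + 3200 * w ^ 6 - 1024 * w ^ 7 + 128 * w ^ 8 - 64 * y + 64 * w * y + 512 * w ^ 2 * y
      - 1536 * w ^ 3 * y + 1664 * w ^ 4 * y - 768 * w ^ 5 * y + 128 * w ^ 6 * y) * hyy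
  have hX0 : X ≠ 0 := by
    intro h
    have hy' : y = -1 / 2 - (w ^ 2 - 2 * w) := by
      rw [h] at hX; field_simp; linear_combination -hX
    rw [hy'] at hyy
    have : (2 * w - 1) ^ 2 = 0 := by linear_combination 4 * hyy
    exact hwh (pow_eq_zero_iff two_ne_zero |>.mp this)
  have hX1 : X ≠ 1 := by
    intro h
    have hy' : 2 * y = - 2 * (w ^ 2 - 2 * w) := by rw [h] at hX; linear_combination -hX
    have hy'' : y = -(w ^ 2 - 2 * w) := by apply mul_left_cancel₀ two; rw [hy']; ring
    rw [hy''] at hyy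
    exact hw0 (by linear_combination hyy)
  have hXm : X ≠ -1 := by
    intro h
    have hy' : 2 * y = 2 * (-1 - (w ^ 2 - 2 * w)) := by rw [h] at hX; linear_combination -hX
    have hy'' := mul_left_cancel₀ two hy'
    rw [hy''] at hyy
    have : (2 * w - 1) * (1 - w) = 0 := by linear_combination -hyy
    rcases mul_eq_zero.mp this with h | h
    · exact hwh h
    · exact hw1 h
  have hh : Y - 2 * X + 1 ≠ 0 := by
    intro h
    have hY' : Y = 2 * X - 1 := by linear_combination h
    rw [hY'] at hYY
    have : (X - 1) ^ 3 = 0 := by linear_combination -hYY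
    exact hX1 (sub_eq_zero.mp (pow_eq_zero_iff three_ne_zero |>.mp this))
  refine ⟨X, s * (1 - w) ^ 2 * (Y - 2 * X + 1) / X, ?_, hX0, hX1, hXm, ?_⟩
  · have e : (s * (1 - w) ^ 2 * (Y - 2 * X + 1) / X) ^ 2 = -Y := by
      rw [div_pow, div_eq_iff (pow_ne_zero _ hX0)]
      have four : (4 : K) ≠ 0 := by norm_num
      apply mul_left_cancel₀ four
      linear_combination hFh
    have : ∀ z : K, z ^ 4 = (z ^ 2) ^ 2 := fun z => by ring
    rw [this, e, ← hYY]; ring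
  · exact div_ne_zero (mul_ne_zero (mul_ne_zero hs (pow_ne_zero _ hw1)) hh) hX0

theorem X20.group {G : Type*} [AddCommGroup G] (σ : G →+ G) (hσ : ∀ g, σ (σ g) = g) (T0 : G)
    (hT0 : ∀ g, σ g = g → 2 • g = 0 → g = 0 ∨ g = T0) (P Q t1 t2 : G) (hP : P ≠ 0)
    (hP5 : 5 • P = 0) (hQ : 2 • Q ≠ 0) (hQ4 : 4 • Q = 0) (ht1 : t1 ≠ 0) (ht2 : t2 ≠ 0)
    (ht : t1 ≠ t2) (h1 : 2 • t1 = 0) (h2 : 2 • t2 = 0) :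
    ∃ P Q : G, P ≠ 0 ∧ 5 • P = 0 ∧ 2 • Q ≠ 0 ∧ 4 • Q = 0 ∧
      ((σ P = P ∧ σ Q = Q) ∨ (σ P = -P ∧ σ Q = -Q)) := by
  obtain ⟨T, hT, hT2, hTT⟩ : ∃ T : G, T ≠ 0 ∧ 2 • T = 0 ∧ T ≠ T0 := by
    by_cases h : t1 = T0
    · exact ⟨t2, ht2, h2, fun h' => ht (h.trans h'.symm)⟩
    · exact ⟨t1, ht1, h1, h⟩
  have two : ∀ g : G, 2 • g = 0 → -g = g := fun g hg => by
    rw [two_nsmul] at hg; exact neg_eq_of_add_eq_zero_left hg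
  have hσT : σ T = T + T0 := by
    have hne : σ T ≠ T := fun h => by
      rcases hT0 T h hT2 with h | h
      · exact hT h
      · exact hTT h
    have h3 : σ (σ T - T) = σ T - T := by
      rw [map_sub, hσ, ← neg_sub, two]
      rw [smul_sub, ← map_nsmul, hT2, map_zero, sub_zero]
    rcases hT0 _ h3 (by rw [smul_sub, ← map_nsmul, hT2, map_zero, sub_zero]) with h | h
    · exact absurd (sub_eq_zero.mp h) hne
    · rw [← h]; abel
  have hT02 : 2 • T0 = 0 := by
    have : T0 = σ T - T := by rw [hσT]; abel
    rw [this, smul_sub, ← map_nsmul, hT2, map_zero, sub_zero]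
  have hT00 : T0 ≠ 0 := fun h => by
    rw [h, add_zero] at hσT
    rcases hT0 T hσT hT2 with h' | h'
    · exact hT h'
    · exact hTT h'
  have key : ∃ Q1 Q2 : G, 2 • Q1 = T0 ∧ 2 • Q2 = T0 ∧ σ Q1 = Q1 ∧ σ Q2 = -Q2 := by
    have shift : ∀ g, 2 • g = T0 → 2 • (g + T) = T0 := fun g hg => by
      rw [smul_add, hg, hT2, add_zero]
    by_cases hq : σ (2 • Q) = 2 • Q
    · have hq' : 2 • Q = T0 := by
        rcases hT0 _ hq (by rw [smul_smul]; exact hQ4) with h | h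
        · exact absurd h hQ
        · exact h
      have hD2 : 2 • (σ Q - Q) = 0 := by rw [smul_sub, ← map_nsmul, hq, sub_self]
      have hD : σ (σ Q - Q) = σ Q - Q := by
        rw [map_sub, hσ, ← neg_sub, two _ hD2]
      rcases hT0 _ hD hD2 with h | h
      · have hQf : σ Q = Q := sub_eq_zero.mp h
        refine ⟨Q, Q + T, hq', shift _ hq', hQf, ?_⟩
        rw [map_add, hQf, hσT, neg_add, two _ hT2]
        have : Q + T0 = -Q := by
          have h3 := two _ hT02
          rw [← h3, ← hq', two_nsmul]; abel
        rw [← this]; abel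
      · have hQf : σ Q = -Q := by
          have h3 := two _ hT02
          rw [← hq', two_nsmul] at h
          rw [← hq', two_nsmul] at h3
          have : σ Q = Q + (Q + Q) := by rw [← h]; abel
          rw [this, ← h3]; abel
        refine ⟨Q + T, Q, shift _ hq', hq', ?_, hQf⟩
        rw [map_add, hQf, hσT, ← hq', two_nsmul]; abel
    · have hRf : σ (Q + σ Q) = Q + σ Q := by rw [map_add, hσ, add_comm]
      have hR4 : 2 • (2 • (Q + σ Q)) = 0 := by
        rw [smul_smul, smul_add, ← map_nsmul]
        have : (2 * 2) • Q = 0 := hQ4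
        rw [this, map_zero, add_zero]
      have hR2f : σ (2 • (Q + σ Q)) = 2 • (Q + σ Q) := by rw [map_nsmul, hRf]
      have hR : 2 • (Q + σ Q) = T0 := by
        rcases hT0 _ hR2f hR4 with h | h
        · exfalso
          apply hq
          rw [smul_add, ← map_nsmul] at h
          rw [eq_neg_of_add_eq_zero_right h]
          apply two
          rw [smul_smul]; exact hQ4
        · exact h
      refine ⟨Q + σ Q, Q + σ Q + T, hR, shift _ hR, hRf, ?_⟩
      rw [map_add, hRf, hσT, neg_add _ T, two _ hT2]
      have : Q + σ Q + T0 = -(Q + σ Q) := by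
        have h3 := two _ hT02
        rw [← h3, ← hR, two_nsmul]; abel
      rw [← this]; abel
  obtain ⟨Q1, Q2, hQ1, hQ2, hf1, hf2⟩ := key
  have four : ∀ g : G, 2 • g = T0 → 4 • g = 0 := fun g hg => by
    rw [show 4 = 2 * 2 from rfl, mul_smul, hg, hT02]
  by_cases hp : P + σ P = 0
  · exact ⟨P, Q2, hP, hP5, by rwa [hQ2], four _ hQ2,
      Or.inr ⟨eq_neg_of_add_eq_zero_right hp, hf2⟩⟩
  · exact ⟨P + σ P, Q1, hp, by rw [smul_add, ← map_nsmul, hP5, map_zero, add_zero],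
      by rwa [hQ1], four _ hQ1, Or.inl ⟨by rw [map_add, hσ, add_comm], hf1⟩⟩

theorem X20.double {F : Type*} [Field F] [CharZero F] [DecidableEq F]
    (W : WeierstrassCurve.Affine F)
    {x y x' y' : F} (h : W.Nonsingular x y) (h' : W.Nonsingular x' y')
    (hd : WeierstrassCurve.Affine.Point.some x y h + WeierstrassCurve.Affine.Point.some x y h
      = WeierstrassCurve.Affine.Point.some x' y' h') :
    y + (W.a₁ * x + W.a₃) / 2 ≠ 0 ∧
    ∃ l : F, 2 * (y + (W.a₁ * x + W.a₃) / 2) * l = 3 * x ^ 2 + 2 * (W.a₂ + W.a₁ ^ 2 / 4) * x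
        + (W.a₄ + W.a₁ * W.a₃ / 2) ∧
      l ^ 2 = (W.a₂ + W.a₁ ^ 2 / 4) + 2 * x + x' ∧
      y' + (W.a₁ * x' + W.a₃) / 2 = -(y + (W.a₁ * x + W.a₃) / 2 + l * (x' - x)) := by
  have hy : y ≠ W.negY x y := by
    intro hy
    rw [WeierstrassCurve.Affine.Point.add_self_of_Y_eq hy] at hd
    exact WeierstrassCurve.Affine.Point.some_ne_zero _ hd.symm
  have hy0 : y + (W.a₁ * x + W.a₃) / 2 ≠ 0 := by
    intro h0
    apply hy
    rw [WeierstrassCurve.Affine.negY]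
    linear_combination 2 * h0
  refine ⟨hy0, W.slope x x y y + W.a₁ / 2, ?_, ?_, ?_⟩
  · rw [WeierstrassCurve.Affine.slope_of_Y_ne rfl hy]
    have : y - W.negY x y ≠ 0 := sub_ne_zero.mpr hy
    have e : 2 * (y + (W.a₁ * x + W.a₃) / 2) = y - W.negY x y := by
      rw [WeierstrassCurve.Affine.negY]; ring
    rw [mul_add, e, mul_div_cancel₀ _ this, WeierstrassCurve.Affine.negY]
    ring
  · rw [WeierstrassCurve.Affine.Point.add_self_of_Y_ne hy] at hd
    simp only [WeierstrassCurve.Affine.Point.some.injEq] at hd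
    rw [← hd.1, WeierstrassCurve.Affine.addX]; ring
  · rw [WeierstrassCurve.Affine.Point.add_self_of_Y_ne hy] at hd
    simp only [WeierstrassCurve.Affine.Point.some.injEq] at hd
    rw [← hd.2, ← hd.1, WeierstrassCurve.Affine.addY, WeierstrassCurve.Affine.negAddY,
      WeierstrassCurve.Affine.negY]; ring

theorem X20.eqn {F : Type*} [Field F] [CharZero F]
    (W : WeierstrassCurve.Affine F) {x y : F} (h : W.Nonsingular x y) :
    (y + (W.a₁ * x + W.a₃) / 2) ^ 2 = x ^ 3 + (W.a₂ + W.a₁ ^ 2 / 4) * x ^ 2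
      + (W.a₄ + W.a₁ * W.a₃ / 2) * x + (W.a₆ + W.a₃ ^ 2 / 4) := by
  have := (WeierstrassCurve.Affine.equation_iff _ _).mp h.1
  linear_combination this

theorem X20.core {K L : Type*} [Field K] [Field L] [Algebra K L] [CharZero K] [CharZero L]
    (σ : L →ₐ[K] L) (hfix : ∀ x, σ x = x → ∃ a, algebraMap K L a = x)
    (A B C ε x₁ y₁ x₂ y₂ l m e u v n : L) (hA : σ A = A) (hB : σ B = B)
    (hε : ε ^ 2 = 1) (hsx : σ x₁ = x₁) (hsy : σ y₁ = ε * y₁) (hsu : σ u = u) (hsv : σ v = ε * v)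
    (hy0 : y₁ ≠ 0) (hx12 : x₁ ≠ x₂) (hv0 : v ≠ 0)
    (e1 : y₁ ^ 2 = x₁ ^ 3 + A * x₁ ^ 2 + B * x₁ + C)
    (e2 : 2 * y₁ * l = 3 * x₁ ^ 2 + 2 * A * x₁ + B) (e3 : l ^ 2 = A + 2 * x₁ + x₂)
    (e4 : y₂ = -(y₁ + l * (x₂ - x₁)))
    (e5 : m ^ 2 = A + 2 * x₂ + x₁) (e6 : -y₁ = -(y₂ + m * (x₁ - x₂)))
    (f1 : v ^ 2 = u ^ 3 + A * u ^ 2 + B * u + C)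
    (f2 : 2 * v * n = 3 * u ^ 2 + 2 * A * u + B) (f3 : n ^ 2 = A + 2 * u + e)
    (f4 : 0 = -(v + n * (e - u))) (f5 : 0 = e ^ 3 + A * e ^ 2 + B * e + C) :
    ∃ t x c s : K, t ≠ 0 ∧ x ≠ 0 ∧ s ≠ 0 ∧
      t ^ 2 * (x + 1) ^ 2 - 2 * t * x * (3 * x + 1) + x ^ 2 * (4 * x + 1) = 0 ∧
      2 * c ^ 2 = 6 * x ^ 2 + (t ^ 2 - 6 * t + 1) * x + (t ^ 2 - t) ∧
      4 * s ^ 2 = 12 * x + (t ^ 2 - 6 * t + 1) + 8 * c := by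
  have two : (2 : L) ≠ 0 := two_ne_zero
  have hε0 : ε ≠ 0 := by rintro rfl; norm_num at hε
  have hsl : σ l = ε * l := by
    have h := congrArg σ e2
    simp only [map_mul, map_add, map_pow, hA, hB, hsx, hsy, map_ofNat] at h
    rw [← e2] at h
    apply mul_left_cancel₀ (mul_ne_zero (mul_ne_zero two hε0) hy0)
    linear_combination h - 2 * y₁ * l * hε
  have hsn : σ n = ε * n := by
    have h := congrArg σ f2
    simp only [map_mul, map_add, map_pow, hA, hB, hsu, hsv, map_ofNat] at h
    rw [← f2] at h
    apply mul_left_cancel₀ (mul_ne_zero (mul_ne_zero two hε0) hv0)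
    linear_combination h - 2 * v * n * hε
  have hsx2 : σ x₂ = x₂ := by
    have h : x₂ = l ^ 2 - A - 2 * x₁ := by linear_combination -e3
    rw [h]
    simp only [map_sub, map_mul, map_pow, hA, hsx, hsl, map_ofNat]
    linear_combination l ^ 2 * hε
  have hse : σ e = e := by
    have h : e = n ^ 2 - A - 2 * u := by linear_combination -f3
    rw [h]
    simp only [map_sub, map_mul, map_pow, hA, hsu, hsn, map_ofNat]
    linear_combination n ^ 2 * hε
  have hx12' : x₂ - x₁ ≠ 0 := sub_ne_zero.mpr hx12.symm
  obtain ⟨p, hp⟩ : ∃ p, p = l + m := ⟨_, rfl⟩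
  obtain ⟨q, hq⟩ : ∃ q, q = l - m := ⟨_, rfl⟩
  have hpq : x₂ = x₁ - p * q := by rw [hp, hq]; linear_combination e3 - e5
  have hp0 : p ≠ 0 := by rintro h; rw [h] at hpq; apply hx12'; rw [hpq]; ring
  have hq0 : q ≠ 0 := by rintro h; rw [h] at hpq; apply hx12'; rw [hpq]; ring
  have hyp : 2 * y₁ = -p * (x₂ - x₁) := by rw [hp]; linear_combination e4 - e6
  have hyp' : y₁ = p ^ 2 * q / 2 := by
    rw [eq_div_iff two]; rw [hpq] at hyp; linear_combination hyp
  have hsp : σ p = ε * p := by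
    have h := congrArg σ hyp
    simp only [map_mul, map_sub, map_neg, hsx, hsx2, hsy, map_ofNat] at h
    apply mul_right_cancel₀ hx12'
    linear_combination h - ε * hyp
  have hsm : σ m = ε * m := by
    have : m = p - l := by rw [hp]; ring
    rw [this, map_sub, hsp, hsl]; ring
  have hsq : σ q = ε * q := by rw [hq, map_sub, hsl, hsm]; ring
  have hn0 : n ≠ 0 := by
    rintro rfl; apply hv0; linear_combination f4
  have hc0 : u - e ≠ 0 := by
    intro h; apply hv0; linear_combination f4 + n * h
  have hl : l = (p + q) / 2 := by rw [eq_div_iff two, hp, hq]; ring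
  have hAA : A = l ^ 2 - 3 * x₁ + p * q := by rw [e3, hpq]; ring
  have hBB : B = 2 * y₁ * l - 3 * x₁ ^ 2 - 2 * A * x₁ := by rw [e2]; ring
  have hCC : C = y₁ ^ 2 - x₁ ^ 3 - A * x₁ ^ 2 - B * x₁ := by rw [e1]; ring
  have hb : 3 * e ^ 2 + 2 * A * e + B = (u - e) ^ 2 := by
    apply mul_left_cancel₀ hc0
    have hv : v = n * (u - e) := by linear_combination f4
    rw [hv] at f1
    linear_combination -f1 + f5 + (u - e) ^ 2 * f3
  have hex : e - x₁ ≠ 0 := by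
    intro h
    have : e = x₁ := sub_eq_zero.mp h
    rw [this, ← e1] at f5
    exact hy0 (pow_eq_zero_iff two_ne_zero |>.mp f5.symm)
  have hσq : ∀ a b : L, b ≠ 0 → σ a = ε * a → σ b = ε * b → σ (a / b) = a / b := by
    intro a b hb ha hb'
    rw [map_div₀, ha, hb', mul_div_mul_left _ _ hε0]
  have hσr : ∀ a b : L, σ a = a → σ b = ε * b → σ (a / b ^ 2) = a / b ^ 2 := by
    intro a b ha hb'
    rw [map_div₀, map_pow, ha, hb', mul_pow, hε, one_mul]
  obtain ⟨t, ht⟩ := hfix (-q / p) (hσq _ _ hp0 (by rw [map_neg, hsq]; ring) hsp)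
  obtain ⟨x, hx⟩ := hfix ((e - x₁) / p ^ 2) (hσr _ _ (by rw [map_sub, hse, hsx]) hsp)
  obtain ⟨c, hc⟩ := hfix ((u - e) / p ^ 2) (hσr _ _ (by rw [map_sub, hse, hsu]) hsp)
  obtain ⟨s, hs⟩ := hfix (n / p) (hσq _ _ hp0 hsn hsp)
  have inj := (algebraMap K L).injective
  have nz : ∀ a : K, algebraMap K L a ≠ 0 → a ≠ 0 := by
    rintro a ha rfl; exact ha (map_zero _)
  have he : e = x₁ + p ^ 2 * algebraMap K L x := by rw [hx]; field_simp; ring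
  have hu : u - e = p ^ 2 * algebraMap K L c := by rw [hc]; field_simp
  have hnn : n = p * algebraMap K L s := by rw [hs]; field_simp
  have hqq : q = -p * algebraMap K L t := by rw [ht]; field_simp
  have four : (4 : L) ≠ 0 := by norm_num
  refine ⟨t, x, c, s, nz _ ?_, nz _ ?_, nz _ ?_, inj ?_, inj ?_, inj ?_⟩
  · rw [ht]; exact div_ne_zero (neg_ne_zero.mpr hq0) hp0
  · rw [hx]; exact div_ne_zero hex (pow_ne_zero _ hp0)
  · rw [hs]; exact div_ne_zero hn0 hp0
  · simp only [map_mul, map_add, map_sub, map_pow, map_ofNat, map_one, map_zero]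
    apply mul_left_cancel₀ (pow_ne_zero 6 hp0)
    rw [hCC, hBB, hAA, hyp', hl, hqq, he] at f5
    linear_combination -4 * f5
  · simp only [map_mul, map_add, map_sub, map_pow, map_ofNat, map_one]
    apply mul_left_cancel₀ (pow_ne_zero 4 hp0)
    rw [hu, hBB, hAA, hyp', hl, hqq, he] at hb
    linear_combination -2 * hb
  · simp only [map_mul, map_add, map_sub, map_pow, map_ofNat, map_one]
    apply mul_left_cancel₀ (pow_ne_zero 2 hp0)
    have hu' : u = e + p ^ 2 * algebraMap K L c := by rw [← hu]; ring
    rw [hu', hAA, hl, hqq, hnn, he] at f3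
    linear_combination 4 * f3

theorem X20.coords {F : Type*} [Field F] [CharZero F] [DecidableEq F]
    (W : WeierstrassCurve.Affine F) (P Q : W.Point) (hP : P ≠ 0) (hP5 : 5 • P = 0)
    (hQ : 2 • Q ≠ 0) (hQ4 : 4 • Q = 0) :
    ∃ (x₁ y₁ x₂ y₂ u v e w : F) (h₁ : W.Nonsingular x₁ y₁) (h₂ : W.Nonsingular x₂ y₂)
      (h₃ : W.Nonsingular u v) (h₄ : W.Nonsingular e w),
      P = .some x₁ y₁ h₁ ∧ Q = .some u v h₃ ∧ x₁ ≠ x₂ ∧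
      WeierstrassCurve.Affine.Point.some x₁ y₁ h₁ + .some x₁ y₁ h₁ = .some x₂ y₂ h₂ ∧
      WeierstrassCurve.Affine.Point.some x₂ y₂ h₂ + .some x₂ y₂ h₂
        = -WeierstrassCurve.Affine.Point.some x₁ y₁ h₁ ∧
      WeierstrassCurve.Affine.Point.some u v h₃ + .some u v h₃ = .some e w h₄ ∧
      w + (W.a₁ * e + W.a₃) / 2 = 0 := by
  have hP2 : P + P ≠ 0 := by
    intro h
    apply hP
    have : 5 • P = (P + P) + (P + P) + P := by abel
    rw [h, hP5] at this
    simpa using this.symm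
  have hP4 : (P + P) + (P + P) = -P := by
    have : (P + P) + (P + P) = 5 • P - P := by abel
    rw [this, hP5, zero_sub]
  have hP3 : P ≠ P + P := fun h => hP (by simpa using h)
  have hP3' : P ≠ -(P + P) := fun h => by
    have h3 : 3 • P = 0 := by
      have : 3 • P = P + (P + P) := by abel
      rw [this]; nth_rewrite 1 [h]; abel
    apply hP
    have : P = 2 • (3 • P) - 5 • P := by abel
    rw [this, h3, hP5]; simp
  have hQ2 : Q + Q ≠ 0 := by rwa [two_nsmul] at hQ
  have hQ4' : (Q + Q) + (Q + Q) = 0 := by rw [← hQ4]; abel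
  obtain ⟨P2, hP2e⟩ : ∃ R, R = P + P := ⟨_, rfl⟩
  obtain ⟨Q2, hQ2e⟩ : ∃ R, R = Q + Q := ⟨_, rfl⟩
  rw [← hP2e] at hP2 hP4 hP3 hP3'
  rw [← hQ2e] at hQ2 hQ4'
  rcases P with _ | ⟨x₁, y₁, h₁⟩
  · exact absurd rfl hP
  rcases Q with _ | ⟨u, v, h₃⟩
  · exact absurd rfl (hQ2e ▸ hQ2)
  rcases P2 with _ | ⟨x₂, y₂, h₂⟩
  · exact absurd rfl hP2
  rcases Q2 with _ | ⟨e, w, h₄⟩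
  · exact absurd rfl hQ2
  refine ⟨x₁, y₁, x₂, y₂, u, v, e, w, h₁, h₂, h₃, h₄, rfl, rfl, ?_, hP2e.symm, hP4, hQ2e.symm, ?_⟩
  · intro h
    rcases (WeierstrassCurve.Affine.Point.X_eq_iff (h₁ := h₁) (h₂ := h₂)).mp h with h | h
    · exact hP3 h
    · exact hP3' h
  · have := eq_neg_of_add_eq_zero_left hQ4'
    rw [WeierstrassCurve.Affine.Point.neg_some] at this
    simp only [WeierstrassCurve.Affine.Point.some.injEq] at this
    have h := this.2
    rw [WeierstrassCurve.Affine.negY] at h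
    linear_combination h / 2

theorem X20.main {K : Type*} [Field K] [NumberField K] (hK : Module.finrank ℚ K = 2)
    {L : Type*} [Field L] [CharZero L] [DecidableEq L] [Algebra K L] (W : WeierstrassCurve K)
    (σ : L →ₐ[K] L) (hfix : ∀ x, σ x = x → ∃ a, algebraMap K L a = x)
    (P Q : (W⁄L).Point) (hP : P ≠ 0) (hP5 : 5 • P = 0)
    (hQ : 2 • Q ≠ 0) (hQ4 : 4 • Q = 0)
    (hσ : (Point.map σ P = P ∧ Point.map σ Q = Q) ∨ (Point.map σ P = -P ∧ Point.map σ Q = -Q)) :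
    False := by
  obtain ⟨x₁, y₁, x₂, y₂, u, v, e, w, h₁, h₂, h₃, h₄, rfl, rfl, hx, d1, d2, d3, hw⟩ :=
    X20.coords _ P Q hP hP5 hQ hQ4
  rw [Point.neg_some] at d2
  obtain ⟨hy0, l, e2, e3, e4⟩ := X20.double _ _ _ d1
  obtain ⟨-, m, -, e5, e6⟩ := X20.double _ _ _ d2
  obtain ⟨hv0, n, f2, f3, f4⟩ := X20.double _ _ _ d3
  have e1 := X20.eqn _ h₁
  have f1 := X20.eqn _ h₃
  have f5 := X20.eqn _ h₄
  rw [hw] at f4 f5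
  have s1 : σ (W⁄L).a₁ = (W⁄L).a₁ := by simp
  have s2 : σ (W⁄L).a₂ = (W⁄L).a₂ := by simp
  have s3 : σ (W⁄L).a₃ = (W⁄L).a₃ := by simp
  have s4 : σ (W⁄L).a₄ = (W⁄L).a₄ := by simp
  have hA : σ ((W⁄L).a₂ + (W⁄L).a₁ ^ 2 / 4) = (W⁄L).a₂ + (W⁄L).a₁ ^ 2 / 4 := by
    rw [map_add, map_div₀, map_pow, s1, s2, map_ofNat]
  have hB : σ ((W⁄L).a₄ + (W⁄L).a₁ * (W⁄L).a₃ / 2) = (W⁄L).a₄ + (W⁄L).a₁ * (W⁄L).a₃ / 2 := by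
    rw [map_add, map_div₀, map_mul, s1, s3, s4, map_ofNat]
  have e6' : -(y₁ + ((W⁄L).a₁ * x₁ + (W⁄L).a₃) / 2)
      = -(y₂ + ((W⁄L).a₁ * x₂ + (W⁄L).a₃) / 2 + m * (x₁ - x₂)) := by
    rw [← e6, WeierstrassCurve.Affine.negY]; ring
  obtain ⟨ε, hε, hsx, hsy, hsu, hsv⟩ : ∃ ε : L, ε ^ 2 = 1 ∧ σ x₁ = x₁ ∧
      σ (y₁ + ((W⁄L).a₁ * x₁ + (W⁄L).a₃) / 2) = ε * (y₁ + ((W⁄L).a₁ * x₁ + (W⁄L).a₃) / 2) ∧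
      σ u = u ∧
      σ (v + ((W⁄L).a₁ * u + (W⁄L).a₃) / 2) = ε * (v + ((W⁄L).a₁ * u + (W⁄L).a₃) / 2) := by
    simp only [Point.neg_some, Point.map_some, Point.some.injEq] at hσ
    rcases hσ with ⟨⟨a, b⟩, c, d⟩ | ⟨⟨a, b⟩, c, d⟩
    · refine ⟨1, by norm_num, a, ?_, c, ?_⟩
      · rw [map_add, map_div₀, map_add, map_mul, s1, s3, map_ofNat, a, b]; ring
      · rw [map_add, map_div₀, map_add, map_mul, s1, s3, map_ofNat, c, d]; ring
    · refine ⟨-1, by norm_num, a, ?_, c, ?_⟩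
      · rw [map_add, map_div₀, map_add, map_mul, s1, s3, map_ofNat, a, b,
          WeierstrassCurve.Affine.negY]; ring
      · rw [map_add, map_div₀, map_add, map_mul, s1, s3, map_ofNat, c, d,
          WeierstrassCurve.Affine.negY]; ring
  obtain ⟨t, x, c, s, ht, hx0, hs, g1, g2, g3⟩ :=
    X20.core σ hfix _ _ _ ε x₁ _ x₂ _ l m e u _ n hA hB hε hsx hsy hsu hsv hy0 hx hv0
      e1 e2 e3 e4 e5 e6' f1 f2 f3 f4 (by rw [← f5]; ring)
  obtain ⟨X, S, hXS, hX0, hX1, hXm, hS⟩ := X20.param t x c s ht hx0 hs g1 g2 g3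
  rcases X20.quadratic_points hK X S hXS with h | h | h | h
  · exact hX0 h
  · exact hX1 h
  · exact hXm h
  · exact hS h

open scoped Classical in
/-- Let `K` be a quadratic number field, `E` an elliptic curve over `K`, and
`L` a quadratic extension of `K`. If `E(K)[2] ≃ C₂`, then `E(L)` contains no subgroup
isomorphic to `C₂ ⊕ C₂₀`. -/
theorem stmt5 {K : Type*} [Field K] [NumberField K] (hK : Module.finrank ℚ K = 2)
    {L : Type*} [Field L] [Algebra K L] (hL : Module.finrank K L = 2)
    (W : WeierstrassCurve K) (hW : W.Δ ≠ 0)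
    (h2 : Nonempty (nTorsion ((W⁄K).Point) 2 ≃+ ZMod 2)) :
    ¬ ∃ H : AddSubgroup ((W⁄L).Point), Nonempty (H ≃+ (ZMod 2 × ZMod 20)) := by
  rintro ⟨H, ⟨φ⟩⟩
  have hcL : CharZero L := charZero_of_injective_algebraMap (algebraMap K L).injective
  obtain ⟨σ, hσσ, hfix⟩ := X20.exists_conj K L hL
  obtain ⟨ψ⟩ := h2
  obtain ⟨g, hg⟩ : ∃ g : (ZMod 2 × ZMod 20) →+ (W⁄L).Point, Function.Injective g :=
    ⟨H.subtype.comp φ.symm.toAddMonoidHom, H.subtype_injective.comp φ.symm.injective⟩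
  have hg0 : ∀ a, a ≠ 0 → g a ≠ 0 := fun a ha h => ha (hg (h.trans (map_zero g).symm))
  have hgn : ∀ (n : ℕ) a, n • a = 0 → n • g a = 0 := fun n a ha => by
    rw [← map_nsmul, ha, map_zero]
  have hinv : ∀ R : (W⁄L).Point, Point.map σ (Point.map σ R) = R := by
    rintro (_ | ⟨x, y, h⟩)
    · rfl
    · simp only [Point.map_some, Point.some.injEq]
      exact ⟨hσσ x, hσσ y⟩
  obtain ⟨T0, hT0⟩ : ∃ T0 : (W⁄L).Point, ∀ R : (W⁄L).Point,
      Point.map σ R = R → 2 • R = 0 → R = 0 ∨ R = T0 := by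
    refine ⟨Point.map (Algebra.ofId K L) (ψ.symm 1 : (W⁄K).Point), fun R hR hR2 => ?_⟩
    obtain ⟨R', rfl⟩ : ∃ R' : (W⁄K).Point, Point.map (Algebra.ofId K L) R' = R := by
      rcases R with _ | ⟨x, y, h⟩
      · exact ⟨0, rfl⟩
      · simp only [Point.map_some, Point.some.injEq] at hR
        obtain ⟨a, rfl⟩ := hfix x hR.1
        obtain ⟨b, rfl⟩ := hfix y hR.2
        exact ⟨Point.some a b ((WeierstrassCurve.Affine.baseChange_nonsingular W
          (Algebra.ofId K L).injective _ _).mp h), rfl⟩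
    have hR' : 2 • R' = 0 := by
      apply Point.map_injective (Algebra.ofId K L)
      rw [map_nsmul, hR2, map_zero]
    have hz : ∀ z : ZMod 2, z = 0 ∨ z = 1 := by decide
    rcases hz (ψ ⟨R', hR'⟩) with h | h
    · left
      have : (⟨R', hR'⟩ : nTorsion ((W⁄K).Point) 2) = 0 := by
        rw [← ψ.symm_apply_apply ⟨R', hR'⟩, h, map_zero]
      have h3 : R' = 0 := congrArg Subtype.val this
      rw [h3, map_zero]
    · right
      rw [← h, ψ.symm_apply_apply]
  obtain ⟨P, Q, hP, hP5, hQ, hQ4, hcase⟩ := X20.group (Point.map σ) hinv T0 hT0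
    (g (0, 4)) (g (0, 5)) (g (1, 0)) (g (0, 10)) (hg0 _ (by decide)) (hgn _ _ (by decide))
    (by rw [← map_nsmul]; exact hg0 _ (by decide)) (hgn _ _ (by decide))
    (hg0 _ (by decide)) (hg0 _ (by decide)) (fun h => absurd (hg h) (by decide))
    (hgn _ _ (by decide)) (hgn _ _ (by decide))
  exact X20.main hK W σ hfix P Q hP hP5 hQ hQ4 hcase
end
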